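/- arXiv:1105.3665 — 4 statements merged into one kernel-verified Lean document; each statement's English description precedes it below -/
import Mathlib

section
/- Let G be a finite simple graph with maximal degree Δ = max_{v∈V} deg_G(v). Then the spectral gap of the Swendsen–Wang dynamics satisfies λ(P) ≥ c_SW · λ(P_HB), where c_SW = (1/(2q²)) · (q·e^{2β})^{−4Δ}. -/
open Finset

noncomputable section

/-- Number of connected components of the graph `(V, A)`, counting isolated vertices. -/
def numComp {V : Type*} (A : Finset (Sym2 V)) : ℕ :=
  Nat.card (SimpleGraph.fromEdgeSet (↑A : Set (Sym2 V))).ConnectedComponent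

/-- The set `E(σ)` of edges of `G` whose endpoints receive the same color under `σ`. -/
def monoEdges {V : Type*} [Fintype V] [DecidableEq V] (G : SimpleGraph V)
    [DecidableRel G.Adj] {q : ℕ} (σ : V → Fin q) : Finset (Sym2 V) :=
  G.edgeFinset.filter fun e => ∀ u ∈ e, ∀ w ∈ e, σ u = σ w

/-- The Swendsen–Wang transition matrix on `Ω_P = [q]^V`, with `p = 1 - e^{-β}`. -/
def SW {V : Type*} [Fintype V] [DecidableEq V] (G : SimpleGraph V) [DecidableRel G.Adj]
    (β : ℝ) (q : ℕ) (σ τ : V → Fin q) : ℝ :=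
  ∑ A ∈ (monoEdges G σ ∩ monoEdges G τ).powerset,
    (1 - Real.exp (-β)) ^ A.card * Real.exp (-β) ^ ((monoEdges G σ).card - A.card) *
      ((q : ℝ) ^ numComp A)⁻¹

/-- Partition function `Z(G,β,q)`. -/
def pottsZ {V : Type*} [Fintype V] [DecidableEq V] (G : SimpleGraph V) [DecidableRel G.Adj]
    (β : ℝ) (q : ℕ) : ℝ :=
  ∑ σ : V → Fin q, Real.exp (β * (monoEdges G σ).card)

/-- Boltzmann distribution `π_β` of the `q`-state Potts model on `G`. -/
def potts {V : Type*} [Fintype V] [DecidableEq V] (G : SimpleGraph V) [DecidableRel G.Adj]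
    (β : ℝ) (q : ℕ) (σ : V → Fin q) : ℝ :=
  Real.exp (β * (monoEdges G σ).card) / pottsZ G β q

/-- Heat-bath (single-site Glauber) transition matrix on `Ω_P`. -/
def HB {V : Type*} [Fintype V] [DecidableEq V] (G : SimpleGraph V) [DecidableRel G.Adj]
    (β : ℝ) (q : ℕ) (σ τ : V → Fin q) : ℝ :=
  ((Fintype.card V : ℝ))⁻¹ * ∑ v : V, ∑ k : Fin q,
    if τ = Function.update σ v k then
      potts G β q (Function.update σ v k) / ∑ l : Fin q, potts G β q (Function.update σ v l)
    else 0

/-- `L₂(ν)`-norm of `f`. -/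
def l2norm {Ω : Type*} [Fintype Ω] (ν : Ω → ℝ) (f : Ω → ℝ) : ℝ :=
  Real.sqrt (∑ x, f x ^ 2 * ν x)

/-- Operator norm of the matrix `M` acting on `L₂(ν)`. -/
def opNorm {Ω : Type*} [Fintype Ω] (ν : Ω → ℝ) (M : Ω → Ω → ℝ) : ℝ :=
  sSup {r : ℝ | ∃ f : Ω → ℝ, l2norm ν f ≤ 1 ∧ r = l2norm ν fun x => ∑ y, M x y * f y}

/-- Spectral gap `λ(M) = 1 - ‖M - S_ν‖_ν` of a Markov kernel `M` reversible w.r.t. `ν`. -/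
def specGap {Ω : Type*} [Fintype Ω] (ν : Ω → ℝ) (M : Ω → Ω → ℝ) : ℝ :=
  1 - opNorm ν fun x y => M x y - ν y

/-- Matrix product. -/
def matMul {Ω : Type*} [Fintype Ω] (M N : Ω → Ω → ℝ) : Ω → Ω → ℝ :=
  fun x y => ∑ z, M x z * N z y

end

noncomputable section

section Comparison

variable {Ω : Type*} [Fintype Ω]

/-- The `L₂(ν)` inner product. -/
def l2inner (ν f g : Ω → ℝ) : ℝ := ∑ x, f x * g x * ν x

/-- The action `f ↦ M f` of a matrix on functions. -/
def kernelApp (M : Ω → Ω → ℝ) (f : Ω → ℝ) (x : Ω) : ℝ := ∑ y, M x y * f y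

/-- `M` is a stochastic matrix with stationary distribution `ν`. -/
structure IsStationaryKernel (ν : Ω → ℝ) (M : Ω → Ω → ℝ) : Prop where
  nonneg : ∀ x y, 0 ≤ M x y
  row_sum : ∀ x, ∑ y, M x y = 1
  stationary : ∀ y, ∑ x, ν x * M x y = ν y

/-- A stochastic matrix satisfying detailed balance has `ν` as stationary distribution. -/
lemma IsStationaryKernel.of_reversible {ν : Ω → ℝ} {M : Ω → Ω → ℝ} (h0 : ∀ x y, 0 ≤ M x y)
    (h1 : ∀ x, ∑ y, M x y = 1) (hrev : ∀ x y, ν x * M x y = ν y * M y x) :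
    IsStationaryKernel ν M where
  nonneg := h0
  row_sum := h1
  stationary y := by
    simp_rw [fun x => hrev x y, ← mul_sum, h1, mul_one]

lemma l2norm_eq (ν f : Ω → ℝ) : l2norm ν f = Real.sqrt (l2inner ν f f) := by
  simp [l2norm, l2inner, sq]

lemma l2inner_self_nonneg {ν : Ω → ℝ} (hν : ∀ x, 0 ≤ ν x) (f : Ω → ℝ) : 0 ≤ l2inner ν f f :=
  sum_nonneg fun x _ => mul_nonneg (mul_self_nonneg _) (hν x)

lemma l2inner_sq_le {ν : Ω → ℝ} (hν : ∀ x, 0 ≤ ν x) (f g : Ω → ℝ) :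
    l2inner ν f g ^ 2 ≤ l2inner ν f f * l2inner ν g g := by
  refine sum_sq_le_sum_mul_sum_of_sq_le_mul _ (fun x _ => ?_) (fun x _ => ?_) (fun x _ => ?_)
  · exact mul_nonneg (mul_self_nonneg _) (hν x)
  · exact mul_nonneg (mul_self_nonneg _) (hν x)
  · exact le_of_eq (by ring)

/-- A stochastic matrix contracts the `L₂` norm of its stationary distribution. -/
lemma IsStationaryKernel.contraction {ν : Ω → ℝ} {M : Ω → Ω → ℝ} (hM : IsStationaryKernel ν M)
    (hν : ∀ x, 0 ≤ ν x) (f : Ω → ℝ) :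
    l2inner ν (kernelApp M f) (kernelApp M f) ≤ l2inner ν f f := by
  have jensen (x : Ω) : kernelApp M f x * kernelApp M f x ≤ ∑ y, M x y * (f y * f y) := by
    have := sum_sq_le_sum_mul_sum_of_sq_le_mul univ (r := fun y => M x y * f y)
      (f := fun y => M x y) (g := fun y => M x y * (f y * f y)) (fun y _ => hM.nonneg x y)
      (fun y _ => mul_nonneg (hM.nonneg x y) (mul_self_nonneg _)) (fun y _ => le_of_eq (by ring))
    rwa [hM.row_sum, one_mul, sq] at this
  calc _ ≤ ∑ x, (∑ y, M x y * (f y * f y)) * ν x :=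
        sum_le_sum fun x _ => mul_le_mul_of_nonneg_right (jensen x) (hν x)
    _ = ∑ y, ∑ x, ν x * M x y * (f y * f y) := by
        simp_rw [sum_mul]
        rw [sum_comm]
        exact sum_congr rfl fun y _ => sum_congr rfl fun x _ => by ring
    _ = _ := by
        simp_rw [← sum_mul, hM.stationary]
        exact sum_congr rfl fun y _ => by ring

lemma IsStationaryKernel.mean_app {ν : Ω → ℝ} {M : Ω → Ω → ℝ} (hM : IsStationaryKernel ν M)
    (f : Ω → ℝ) : ∑ x, ν x * kernelApp M f x = ∑ x, ν x * f x := by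
  simp_rw [kernelApp, mul_sum]
  rw [sum_comm]
  simp_rw [← mul_assoc, ← sum_mul, hM.stationary]

lemma IsStationaryKernel.matMul {ν : Ω → ℝ} {M N : Ω → Ω → ℝ} (hM : IsStationaryKernel ν M)
    (hN : IsStationaryKernel ν N) : IsStationaryKernel ν (matMul M N) where
  nonneg x y := sum_nonneg fun z _ => mul_nonneg (hM.nonneg _ _) (hN.nonneg _ _)
  row_sum x := by
    simp only [_root_.matMul]
    rw [sum_comm]
    simp_rw [← mul_sum, hN.row_sum, mul_one, hM.row_sum]
  stationary y := by
    simp only [_root_.matMul, mul_sum]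
    rw [sum_comm]
    simp_rw [← mul_assoc, ← sum_mul, hM.stationary, hN.stationary]

lemma kernelApp_matMul (M N : Ω → Ω → ℝ) (f : Ω → ℝ) :
    kernelApp (matMul M N) f = kernelApp M (kernelApp N f) := by
  funext x
  simp only [kernelApp, matMul, sum_mul, mul_sum]
  rw [sum_comm]
  exact sum_congr rfl fun y _ => sum_congr rfl fun z _ => by ring

/-- The Dirichlet form of a stationary kernel. -/
lemma IsStationaryKernel.dirichlet {ν : Ω → ℝ} {M : Ω → Ω → ℝ} (hM : IsStationaryKernel ν M)
    (f : Ω → ℝ) : ∑ x, ∑ y, ν x * M x y * (f x - f y) ^ 2 =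
      2 * l2inner ν f f - 2 * l2inner ν f (kernelApp M f) := by
  have h1 : ∑ x, ∑ y, ν x * M x y * (f x * f x) = l2inner ν f f := by
    simp_rw [← sum_mul, ← mul_sum, hM.row_sum]
    exact sum_congr rfl fun x _ => by ring
  have h2 : ∑ x, ∑ y, ν x * M x y * (f y * f y) = l2inner ν f f := by
    rw [sum_comm]
    simp_rw [← sum_mul, hM.stationary]
    exact sum_congr rfl fun x _ => by ring
  have h3 : ∑ x, ∑ y, ν x * M x y * (f x * f y) = l2inner ν f (kernelApp M f) := by
    refine sum_congr rfl fun x _ => ?_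
    rw [kernelApp, mul_sum, sum_mul]
    exact sum_congr rfl fun y _ => by ring
  rw [← h3, two_mul, ← h1]
  nth_rewrite 2 [h1]
  rw [← h2, mul_sum, ← sum_add_distrib, ← sum_sub_distrib]
  refine sum_congr rfl fun x _ => ?_
  rw [mul_sum, ← sum_add_distrib, ← sum_sub_distrib]
  exact sum_congr rfl fun y _ => by ring

/-- Subtracting the stationary projection amounts to applying the kernel to the centered
function. -/
lemma IsStationaryKernel.app_sub {ν : Ω → ℝ} {M : Ω → Ω → ℝ} (hM : IsStationaryKernel ν M)
    (f : Ω → ℝ) : (fun x => ∑ y, (M x y - ν y) * f y) =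
      kernelApp M (fun x => f x - ∑ y, ν y * f y) := by
  funext x
  simp only [kernelApp, sub_mul, mul_sub, sum_sub_distrib]
  rw [← sum_mul, hM.row_sum, one_mul]

lemma sum_centered {ν : Ω → ℝ} (hs : ∑ x, ν x = 1) (f : Ω → ℝ) :
    ∑ x, ν x * (f x - ∑ y, ν y * f y) = 0 := by
  simp only [mul_sub, sum_sub_distrib]
  rw [← sum_mul, hs, one_mul, sub_self]

lemma l2inner_centered_le {ν : Ω → ℝ} (hs : ∑ x, ν x = 1) (f : Ω → ℝ) :
    l2inner ν (fun x => f x - ∑ y, ν y * f y) (fun x => f x - ∑ y, ν y * f y) ≤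
      l2inner ν f f := by
  set m := ∑ y, ν y * f y with hm
  have : l2inner ν (fun x => f x - m) (fun x => f x - m) = l2inner ν f f - m ^ 2 := by
    have : ∀ x, (f x - m) * (f x - m) * ν x
        = f x * f x * ν x - 2 * m * (ν x * f x) + m ^ 2 * ν x := fun x => by ring
    simp only [l2inner, this, sum_add_distrib, sum_sub_distrib, ← mul_sum, hs, ← hm]
    ring
  rw [this]
  linarith [sq_nonneg m]

lemma opNorm_le {ν : Ω → ℝ} (hs : ∑ x, ν x = 1) {M : Ω → Ω → ℝ}
    (hM : IsStationaryKernel ν M) {K : ℝ} (hK : 0 ≤ K)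
    (h : ∀ g : Ω → ℝ, ∑ x, ν x * g x = 0 →
      l2inner ν (kernelApp M g) (kernelApp M g) ≤ K ^ 2 * l2inner ν g g) :
    ∀ r ∈ {r : ℝ | ∃ f : Ω → ℝ, l2norm ν f ≤ 1 ∧
      r = l2norm ν fun x => ∑ y, (M x y - ν y) * f y}, r ≤ K := by
  rintro r ⟨f, hf, rfl⟩
  rw [hM.app_sub, l2norm_eq]
  rw [l2norm_eq, Real.sqrt_le_one] at hf
  refine Real.sqrt_le_iff.2 ⟨hK, (h _ (sum_centered hs f)).trans ?_⟩
  have := (l2inner_centered_le hs f).trans hf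
  nlinarith [sq_nonneg K]

lemma opNorm_set_nonempty (ν : Ω → ℝ) (M : Ω → Ω → ℝ) :
    {r : ℝ | ∃ f : Ω → ℝ, l2norm ν f ≤ 1 ∧ r = l2norm ν fun x => ∑ y, M x y * f y}.Nonempty :=
  ⟨_, 0, by simp [l2norm], rfl⟩

lemma opNorm_nonneg (ν : Ω → ℝ) (M : Ω → Ω → ℝ) : 0 ≤ opNorm ν M :=
  Real.sSup_nonneg (by rintro _ ⟨f, -, rfl⟩; exact Real.sqrt_nonneg _)

lemma IsStationaryKernel.le_one {ν : Ω → ℝ} (hν : ∀ x, 0 ≤ ν x) (hs : ∑ x, ν x = 1)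
    {M : Ω → Ω → ℝ} (hM : IsStationaryKernel ν M) :
    ∀ r ∈ {r : ℝ | ∃ f : Ω → ℝ, l2norm ν f ≤ 1 ∧
      r = l2norm ν fun x => ∑ y, (M x y - ν y) * f y}, r ≤ 1 :=
  opNorm_le hs hM zero_le_one fun g _ => by simpa using hM.contraction hν g

/-- On centered functions, `M` contracts by the operator norm of `M - S_ν`. -/
lemma IsStationaryKernel.contraction_opNorm {ν : Ω → ℝ} (hν : ∀ x, 0 ≤ ν x)
    (hs : ∑ x, ν x = 1) {M : Ω → Ω → ℝ} (hM : IsStationaryKernel ν M) {g : Ω → ℝ}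
    (hg : ∑ x, ν x * g x = 0) :
    l2inner ν (kernelApp M g) (kernelApp M g) ≤
      (opNorm ν fun x y => M x y - ν y) ^ 2 * l2inner ν g g := by
  rcases (l2inner_self_nonneg hν g).eq_or_lt with h0 | hpos
  · have := hM.contraction hν g
    rw [← h0] at this ⊢
    simpa using this
  set s := Real.sqrt (l2inner ν g g)
  have hspos : 0 < s := Real.sqrt_pos.2 hpos
  have hs2 : s ^ 2 = l2inner ν g g := Real.sq_sqrt hpos.le
  have scale (u : Ω → ℝ) : l2inner ν (fun x => s⁻¹ * u x) (fun x => s⁻¹ * u x) =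
      s⁻¹ ^ 2 * l2inner ν u u := by
    simp only [l2inner, mul_sum]
    exact sum_congr rfl fun x _ => by ring
  have key : l2norm ν (fun x => ∑ y, (M x y - ν y) * (s⁻¹ * g y)) ≤
      opNorm ν fun x y => M x y - ν y := by
    refine le_csSup ⟨1, hM.le_one hν hs⟩ ⟨fun x => s⁻¹ * g x, ?_, rfl⟩
    rw [l2norm_eq, Real.sqrt_le_one, scale, ← hs2]
    field_simp
    exact le_refl _
  have heq : (fun x => ∑ y, (M x y - ν y) * (s⁻¹ * g y)) = fun x => s⁻¹ * kernelApp M g x := by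
    have hm : ∑ y, ν y * (s⁻¹ * g y) = 0 := by
      simp_rw [mul_left_comm _ s⁻¹, ← mul_sum, hg, mul_zero]
    rw [hM.app_sub, hm]
    funext x
    simp only [kernelApp, sub_zero, mul_left_comm _ s⁻¹, ← mul_sum]
  rw [heq, l2norm_eq, Real.sqrt_le_iff, scale] at key
  have := mul_le_mul_of_nonneg_left key.2 (sq_nonneg s)
  rw [← mul_assoc, ← mul_pow, mul_inv_cancel₀ hspos.ne', one_pow, one_mul, hs2] at this
  linarith

/-- Comparison of spectral gaps: if `P` is reversible and positive semidefinite and `R * P` is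
entrywise dominated by `C * P`, then the gap of `P` is at least `C⁻¹` times that of `R`. -/
theorem specGap_ge_of_matMul_le {ν : Ω → ℝ} (hν : ∀ x, 0 ≤ ν x) (hs : ∑ x, ν x = 1)
    {P R : Ω → Ω → ℝ} (hP : IsStationaryKernel ν P) (hR : IsStationaryKernel ν R)
    (hrev : ∀ x y, ν x * P x y = ν y * P y x)
    (hpos : ∀ f : Ω → ℝ, 0 ≤ l2inner ν f (kernelApp P f))
    {C : ℝ} (hC : 1 ≤ C) (hle : ∀ x y, matMul R P x y ≤ C * P x y) :
    0 ≤ specGap ν R ∧ C⁻¹ * specGap ν R ≤ specGap ν P := by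
  set h := opNorm ν (fun x y => R x y - ν y)
  have hgap : specGap ν R = 1 - h := rfl
  have hh0 : 0 ≤ h := opNorm_nonneg _ _
  have hh1 : h ≤ 1 := csSup_le (opNorm_set_nonempty _ _) (hR.le_one hν hs)
  have hC0 : 0 < C := by linarith
  have hCinv : C⁻¹ ≤ 1 := inv_le_one_of_one_le₀ hC
  have hCinv0 : 0 < C⁻¹ := inv_pos.2 hC0
  set K := 1 - C⁻¹ * (1 - h) with hKdef
  have hK : 0 ≤ K := by nlinarith
  have quad (g : Ω → ℝ) (hg : ∑ x, ν x * g x = 0) :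
      l2inner ν g (kernelApp P g) ≤ K * l2inner ν g g := by
    have hn := l2inner_self_nonneg hν g
    have hQ : l2inner ν g (kernelApp (matMul R P) g) ≤ h * l2inner ν g g := by
      rw [kernelApp_matMul]
      refine abs_le_of_sq_le_sq' ?_ (by positivity) |>.2
      refine (l2inner_sq_le hν _ _).trans ?_
      have h1 := hR.contraction_opNorm hν hs (g := kernelApp P g) (by rw [hP.mean_app, hg])
      have h2 := hP.contraction hν g
      calc _ ≤ l2inner ν g g * (h ^ 2 * l2inner ν g g) := by
            refine mul_le_mul_of_nonneg_left (h1.trans ?_) hn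
            exact mul_le_mul_of_nonneg_left h2 (sq_nonneg _)
        _ = _ := by ring
    have hD : ∑ x, ∑ y, ν x * matMul R P x y * (g x - g y) ^ 2 ≤
        C * ∑ x, ∑ y, ν x * P x y * (g x - g y) ^ 2 := by
      simp_rw [mul_sum]
      refine sum_le_sum fun x _ => sum_le_sum fun y _ => ?_
      have := mul_le_mul_of_nonneg_left (hle x y) (mul_nonneg (hν x) (sq_nonneg (g x - g y)))
      linarith
    rw [(hR.matMul hP).dirichlet, hP.dirichlet] at hD
    have h3 : (1 - h) * l2inner ν g g ≤
        C * (l2inner ν g g - l2inner ν g (kernelApp P g)) := by linarith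
    have h4 := mul_le_mul_of_nonneg_left h3 hCinv0.le
    rw [inv_mul_cancel_left₀ hC0.ne'] at h4
    rw [hKdef]
    linarith
  have symm (f g : Ω → ℝ) : l2inner ν f (kernelApp P g) = l2inner ν (kernelApp P f) g := by
    simp only [l2inner, kernelApp, mul_sum, sum_mul]
    rw [sum_comm]
    refine sum_congr rfl fun y _ => sum_congr rfl fun x _ => ?_
    linear_combination f x * g y * hrev x y
  have norm_le (g : Ω → ℝ) (hg : ∑ x, ν x * g x = 0) :
      l2inner ν (kernelApp P g) (kernelApp P g) ≤ K ^ 2 * l2inner ν g g := by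
    set u := kernelApp P g with hu
    have hq1 := quad g hg
    have hq2 := quad u (by rw [hu, hP.mean_app, hg])
    set m := l2inner ν u u with hm
    set n := l2inner ν g g
    have hm0 : 0 ≤ m := l2inner_self_nonneg hν u
    have hn0 : 0 ≤ n := l2inner_self_nonneg hν g
    have expand (t : ℝ) : l2inner ν (fun x => t * g x - u x)
        (kernelApp P (fun x => t * g x - u x)) =
        t ^ 2 * l2inner ν g u - 2 * t * m + l2inner ν u (kernelApp P u) := by
      have e1 : kernelApp P (fun x => t * g x - u x) = fun x => t * u x - kernelApp P u x := by
        funext x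
        simp only [hu, kernelApp, mul_sub, sum_sub_distrib, mul_sum, mul_left_comm _ t]
      have e2 : m = l2inner ν g (kernelApp P u) := by rw [symm]
      rw [e1, show 2 * t * m = t * m + t * m by ring]
      nth_rewrite 1 [e2]
      simp only [hm, l2inner, mul_sum, ← sum_sub_distrib, ← sum_add_distrib]
      exact sum_congr rfl fun x _ => by ring
    have hd := discrim_le_zero (a := K * n) (b := -2 * m) (c := K * m) fun t => by
      have := hpos fun x => t * g x - u x
      rw [expand] at this
      nlinarith [mul_le_mul_of_nonneg_left hq1 (sq_nonneg t)]
    rw [discrim] at hd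
    rcases hm0.eq_or_lt with h0 | h0
    · rw [← h0]; positivity
    · refine le_of_mul_le_mul_right ?_ h0
      linarith
  have := csSup_le (opNorm_set_nonempty ν fun x y => P x y - ν y) (opNorm_le hs hP hK norm_le)
  have h5 : opNorm ν (fun x y => P x y - ν y) ≤ K := this
  refine ⟨by rw [hgap]; linarith, ?_⟩
  rw [hgap, specGap]
  linarith

end Comparison

section Components

variable {V : Type*}

lemma reachable_insert [DecidableEq V] {A : Finset (Sym2 V)} {u w x y : V}
    (h : (SimpleGraph.fromEdgeSet (↑(insert s(u, w) A) : Set (Sym2 V))).Reachable x y) :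
    let H := SimpleGraph.fromEdgeSet (↑A : Set (Sym2 V))
    H.Reachable x y ∨ ((H.Reachable u x ∨ H.Reachable w x) ∧ (H.Reachable u y ∨ H.Reachable w y)) := by
  intro H
  obtain ⟨p⟩ := h
  induction p with
  | nil => exact Or.inl (SimpleGraph.Reachable.refl _)
  | @cons a b c hab _ ih =>
    simp only [SimpleGraph.fromEdgeSet_adj, coe_insert, Set.mem_insert_iff, mem_coe] at hab
    obtain ⟨hab | hab, hne⟩ := hab
    · have hr : (H.Reachable u a ∨ H.Reachable w a) ∧ (H.Reachable u b ∨ H.Reachable w b) := by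
        rcases Sym2.eq_iff.1 hab with ⟨rfl, rfl⟩ | ⟨rfl, rfl⟩ <;> simp
      refine Or.inr ⟨hr.1, ?_⟩
      rcases ih with ih | ih
      · exact hr.2.imp (·.trans ih) (·.trans ih)
      · exact ih.2
    · have hadj : H.Reachable a b :=
        SimpleGraph.Adj.reachable ((SimpleGraph.fromEdgeSet_adj _).2 ⟨by exact_mod_cast hab, hne⟩)
      rcases ih with ih | ih
      · exact Or.inl (hadj.trans ih)
      · exact Or.inr ⟨ih.1.imp (·.trans hadj.symm) (·.trans hadj.symm), ih.2⟩

lemma numComp_le_insert [Finite V] [DecidableEq V] (e : Sym2 V) (A : Finset (Sym2 V)) :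
    numComp A ≤ numComp (insert e A) + 1 := by
  classical
  induction e with | _ u w
  have hle : SimpleGraph.fromEdgeSet (↑A : Set (Sym2 V)) ≤
      SimpleGraph.fromEdgeSet (↑(insert s(u, w) A) : Set (Sym2 V)) :=
    SimpleGraph.fromEdgeSet_mono (by simp)
  set H := SimpleGraph.fromEdgeSet (↑A : Set (Sym2 V)) with hH
  set H' := SimpleGraph.fromEdgeSet (↑(insert s(u, w) A) : Set (Sym2 V)) with hH'
  let φ : H.ConnectedComponent → Option H'.ConnectedComponent := fun c =>
    if c = H.connectedComponentMk w then none
    else some (c.map (SimpleGraph.Hom.ofLE hle))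
  have hφ : Function.Injective φ := by
    intro c d hcd
    by_cases hc : c = H.connectedComponentMk w <;> by_cases hd : d = H.connectedComponentMk w
    · rw [hc, hd]
    · simp [φ, hc, hd] at hcd
    · simp [φ, hc, hd] at hcd
    · simp only [φ, hc, hd, if_false, Option.some.injEq] at hcd
      induction c using SimpleGraph.ConnectedComponent.ind with | _ x
      induction d using SimpleGraph.ConnectedComponent.ind with | _ y
      simp only [SimpleGraph.ConnectedComponent.map_mk, SimpleGraph.ConnectedComponent.eq] at hcd hc hd ⊢
      rcases reachable_insert hcd with h | ⟨h1, h2⟩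
      · exact h
      · exact (h1.resolve_right fun h => hc h.symm).symm.trans
          (h2.resolve_right fun h => hd h.symm)
  have := Nat.card_le_card_of_injective φ hφ
  rwa [Finite.card_option] at this

lemma numComp_le_union [Finite V] [DecidableEq V] (A B : Finset (Sym2 V)) :
    numComp A ≤ numComp (A ∪ B) + #B := by
  induction B using Finset.induction_on with
  | empty => simp
  | insert e B he ih =>
    rw [union_insert, card_insert_of_notMem he]
    have := numComp_le_insert e (A ∪ B)
    omega

/-- There are `q ^ C(A)` colorings that are constant on the components of `(V, A)`. -/
lemma card_subset_monoEdges [Fintype V] [DecidableEq V] (G : SimpleGraph V)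
    [DecidableRel G.Adj] (q : ℕ) {A : Finset (Sym2 V)} (hA : A ⊆ G.edgeFinset) :
    #{τ : V → Fin q | A ⊆ monoEdges G τ} = q ^ numComp A := by
  classical
  set H := SimpleGraph.fromEdgeSet (↑A : Set (Sym2 V)) with hH
  have mono_iff (τ : V → Fin q) : A ⊆ monoEdges G τ ↔ ∀ x y, H.Adj x y → τ x = τ y := by
    constructor
    · intro h x y hxy
      have := h (by exact_mod_cast ((SimpleGraph.fromEdgeSet_adj _).1 hxy).1)
      exact (mem_filter.1 this).2 x (by simp) y (by simp)
    · intro h e he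
      refine mem_filter.2 ⟨hA he, fun u hu w hw => ?_⟩
      by_cases huw : u = w
      · rw [huw]
      · refine h u w ((SimpleGraph.fromEdgeSet_adj _).2 ⟨?_, huw⟩)
        rw [← (Sym2.mem_and_mem_iff huw).1 ⟨hu, hw⟩]
        exact_mod_cast he
  have walk (τ : V → Fin q) (h : A ⊆ monoEdges G τ) (x y : V) (p : H.Walk x y) : τ x = τ y := by
    induction p with
    | nil => rfl
    | cons hab _ ih => exact ((mono_iff τ).1 h _ _ hab).trans ih
  let e : {τ : V → Fin q // A ⊆ monoEdges G τ} ≃ (H.ConnectedComponent → Fin q) :=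
    { toFun := fun τ c => c.lift τ.1 fun x y p _ => walk τ.1 τ.2 x y p
      invFun := fun f => ⟨fun x => f (H.connectedComponentMk x), (mono_iff _).2 fun x y h => by
        rw [SimpleGraph.ConnectedComponent.eq.2 h.reachable]⟩
      left_inv := fun τ => rfl
      right_inv := fun f => by
        funext c
        induction c using SimpleGraph.ConnectedComponent.ind with | _ x
        rfl }
  rw [← Fintype.card_subtype, ← Nat.card_eq_fintype_card, Nat.card_congr e, Nat.card_fun]
  simp [numComp, hH]

end Components

section Potts

variable {V : Type*} [Fintype V] [DecidableEq V] (G : SimpleGraph V) [DecidableRel G.Adj]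
  (β : ℝ) (q : ℕ)

lemma monoEdges_subset (σ : V → Fin q) : monoEdges G σ ⊆ G.edgeFinset := filter_subset _ _

lemma pottsZ_pos (hq : 0 < q) : 0 < pottsZ G β q :=
  have : NeZero q := ⟨hq.ne'⟩
  sum_pos (fun _ _ => Real.exp_pos _) univ_nonempty

lemma potts_pos (hq : 0 < q) (σ : V → Fin q) : 0 < potts G β q σ :=
  div_pos (Real.exp_pos _) (pottsZ_pos G β q hq)

lemma sum_potts (hq : 0 < q) : ∑ σ, potts G β q σ = 1 := by
  simp only [potts, ← sum_div]
  exact div_self (pottsZ_pos G β q hq).ne'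

/-- The weight of the edge set `A` in the factorization of the Swendsen–Wang matrix through the
random-cluster model. -/
def clusterWeight (A : Finset (Sym2 V)) : ℝ :=
  (1 - Real.exp (-β)) ^ #A * Real.exp (β * #A) * ((q : ℝ) ^ numComp A)⁻¹ / pottsZ G β q

variable {β}

lemma one_sub_exp_neg_nonneg (hβ : 0 ≤ β) : 0 ≤ 1 - Real.exp (-β) := by
  have : Real.exp (-β) ≤ 1 := Real.exp_le_one_iff.2 (by linarith)
  linarith

lemma clusterWeight_nonneg (hq : 0 < q) (hβ : 0 ≤ β) (A : Finset (Sym2 V)) :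
    0 ≤ clusterWeight G β q A := by
  have := one_sub_exp_neg_nonneg hβ
  have := pottsZ_pos G β q hq
  unfold clusterWeight
  positivity

variable (β) in
lemma potts_mul_SW (σ τ : V → Fin q) :
    potts G β q σ * SW G β q σ τ = ∑ A ∈ G.edgeFinset.powerset,
      (if A ⊆ monoEdges G σ then 1 else 0) * (if A ⊆ monoEdges G τ then 1 else 0) *
        clusterWeight G β q A := by
  have hsub : (monoEdges G σ ∩ monoEdges G τ).powerset ⊆ G.edgeFinset.powerset :=
    powerset_mono.2 (inter_subset_left.trans (monoEdges_subset G q σ))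
  rw [← sum_subset hsub, SW, mul_sum]
  · refine sum_congr rfl fun A hA => ?_
    obtain ⟨h1, h2⟩ := subset_inter_iff.1 (mem_powerset.1 hA)
    have hexp : Real.exp (β * #(monoEdges G σ)) * Real.exp (-β) ^ (#(monoEdges G σ) - #A) =
        Real.exp (β * #A) := by
      rw [← Real.exp_nat_mul, ← Real.exp_add, Nat.cast_sub (card_le_card h1)]
      congr 1
      ring
    rw [if_pos h1, if_pos h2, clusterWeight, potts, ← hexp]
    ring
  · intro A _ hA
    rw [mem_powerset, subset_inter_iff, not_and_or] at hA
    rcases hA with hA | hA <;> simp [hA]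

lemma SW_nonneg (hβ : 0 ≤ β) (σ τ : V → Fin q) : 0 ≤ SW G β q σ τ := by
  have := one_sub_exp_neg_nonneg hβ
  exact sum_nonneg fun A _ => by positivity

variable (β) in
lemma SW_reversible (σ τ : V → Fin q) :
    potts G β q σ * SW G β q σ τ = potts G β q τ * SW G β q τ σ := by
  rw [potts_mul_SW, potts_mul_SW]
  exact sum_congr rfl fun A _ => by ring

variable (β) in
lemma SW_row_sum (hq : 0 < q) (σ : V → Fin q) : ∑ τ, SW G β q σ τ = 1 := by
  have hq' : (q : ℝ) ≠ 0 := by positivity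
  have h (τ : V → Fin q) : SW G β q σ τ = ∑ A ∈ (monoEdges G σ).powerset,
      (if A ⊆ monoEdges G τ then 1 else 0) * ((1 - Real.exp (-β)) ^ #A *
        Real.exp (-β) ^ (#(monoEdges G σ) - #A) * ((q : ℝ) ^ numComp A)⁻¹) := by
    simp only [ite_mul, one_mul, zero_mul]
    rw [← sum_filter, SW]
    refine sum_congr ?_ fun _ _ => rfl
    ext A
    simp only [mem_filter, mem_powerset, subset_inter_iff]
  simp_rw [h]
  rw [sum_comm]
  have h2 (A) (hA : A ∈ (monoEdges G σ).powerset) :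
      ∑ τ : V → Fin q, (if A ⊆ monoEdges G τ then 1 else 0) * ((1 - Real.exp (-β)) ^ #A *
        Real.exp (-β) ^ (#(monoEdges G σ) - #A) * ((q : ℝ) ^ numComp A)⁻¹) =
      (1 - Real.exp (-β)) ^ #A * Real.exp (-β) ^ (#(monoEdges G σ) - #A) := by
    rw [← sum_mul, sum_boole, card_subset_monoEdges G q
      ((mem_powerset.1 hA).trans (monoEdges_subset G q σ))]
    push_cast
    field_simp
  rw [sum_congr rfl h2, sum_pow_mul_eq_add_pow]
  simp

lemma SW_isStationaryKernel (hq : 0 < q) (hβ : 0 ≤ β) :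
    IsStationaryKernel (potts G β q) (SW G β q) :=
  .of_reversible (SW_nonneg G q hβ) (SW_row_sum G β q hq) (SW_reversible G β q)

/-- The Swendsen–Wang matrix is positive semidefinite. -/
lemma SW_posSemidef (hq : 0 < q) (hβ : 0 ≤ β) (f : (V → Fin q) → ℝ) :
    0 ≤ l2inner (potts G β q) f (kernelApp (SW G β q) f) := by
  have h : l2inner (potts G β q) f (kernelApp (SW G β q) f) =
      ∑ A ∈ G.edgeFinset.powerset, clusterWeight G β q A *
        (∑ σ : V → Fin q, (if A ⊆ monoEdges G σ then 1 else 0) * f σ) ^ 2 := by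
    calc _ = ∑ σ, ∑ τ, f σ * f τ * (potts G β q σ * SW G β q σ τ) := by
          refine sum_congr rfl fun σ _ => ?_
          rw [kernelApp, mul_sum, sum_mul]
          exact sum_congr rfl fun τ _ => by ring
      _ = _ := by
          simp_rw [potts_mul_SW, mul_sum]
          simp_rw [sum_comm (t := G.edgeFinset.powerset)]
          refine sum_congr rfl fun A _ => ?_
          rw [sq, sum_mul_sum, mul_sum]
          refine sum_congr rfl fun σ _ => ?_
          rw [mul_sum]
          exact sum_congr rfl fun τ _ => by ring
  rw [h]
  exact sum_nonneg fun A _ => mul_nonneg (clusterWeight_nonneg G q hq hβ A) (sq_nonneg _)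

variable (β) in
/-- The conditional probability of the color `k` at `v` given the other colors. -/
def heatBathProb (σ : V → Fin q) (v : V) (k : Fin q) : ℝ :=
  potts G β q (Function.update σ v k) / ∑ l : Fin q, potts G β q (Function.update σ v l)

variable (β) in
lemma heatBathProb_nonneg (hq : 0 < q) (σ : V → Fin q) (v : V) (k : Fin q) :
    0 ≤ heatBathProb G β q σ v k :=
  div_nonneg (potts_pos G β q hq _).le (sum_nonneg fun _ _ => (potts_pos G β q hq _).le)

variable (β) in
lemma sum_heatBathProb (hq : 0 < q) (σ : V → Fin q) (v : V) :
    ∑ k, heatBathProb G β q σ v k = 1 := by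
  have : NeZero q := ⟨hq.ne'⟩
  simp only [heatBathProb, ← sum_div]
  exact div_self (sum_pos (fun _ _ => potts_pos G β q hq _) univ_nonempty).ne'

variable (β) in
/-- Averaging over the heat-bath transitions from `σ`. -/
lemma sum_HB_mul (σ : V → Fin q) (g : (V → Fin q) → ℝ) :
    ∑ τ, HB G β q σ τ * g τ = (Fintype.card V : ℝ)⁻¹ * ∑ v, ∑ k,
      heatBathProb G β q σ v k * g (Function.update σ v k) := by
  simp only [HB, mul_assoc, ← mul_sum, sum_mul]
  rw [sum_comm]
  congr 1
  refine sum_congr rfl fun v _ => ?_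
  rw [sum_comm]
  refine sum_congr rfl fun k _ => ?_
  simp [heatBathProb, ite_mul]

variable (β) in
lemma HB_reversible (σ τ : V → Fin q) :
    potts G β q σ * HB G β q σ τ = potts G β q τ * HB G β q τ σ := by
  have aux (σ τ : V → Fin q) (v : V) :
      ∑ k : Fin q, (if τ = Function.update σ v k then
        potts G β q (Function.update σ v k) /
          ∑ l : Fin q, potts G β q (Function.update σ v l) else 0) =
      if ∀ u, u ≠ v → τ u = σ u then
        potts G β q τ / ∑ l : Fin q, potts G β q (Function.update σ v l) else 0 := by
    split_ifs with h
    · have hτ : τ = Function.update σ v (τ v) := (Function.eq_update_iff.2 ⟨rfl, h⟩)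
      rw [sum_eq_single (τ v), if_pos hτ, ← hτ]
      · intro k _ hk
        refine if_neg fun h' => hk ?_
        rw [h', Function.update_self]
      · simp
    · refine sum_eq_zero fun k _ => if_neg fun h' => h fun u hu => ?_
      rw [h', Function.update_of_ne hu]
  rw [HB, HB, mul_left_comm, mul_left_comm (potts G β q τ)]
  congr 1
  simp only [aux]
  rw [mul_sum, mul_sum]
  refine sum_congr rfl fun v _ => ?_
  by_cases h : ∀ u, u ≠ v → τ u = σ u
  · have h' : ∀ u, u ≠ v → σ u = τ u := fun u hu => (h u hu).symm
    have hup (l : Fin q) : Function.update σ v l = Function.update τ v l := by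
      ext u
      by_cases hu : u = v
      · subst hu; simp
      · simp [hu, h u hu]
    rw [if_pos h, if_pos h']
    simp only [hup]
    ring
  · have h' : ¬ ∀ u, u ≠ v → σ u = τ u := fun h' => h fun u hu => (h' u hu).symm
    rw [if_neg h, if_neg h', mul_zero, mul_zero]

lemma HB_isStationaryKernel [Nonempty V] (hq : 0 < q) :
    IsStationaryKernel (potts G β q) (HB G β q) := by
  refine .of_reversible (fun σ τ => ?_) (fun σ => ?_) (HB_reversible G β q)
  · refine mul_nonneg (by positivity) (sum_nonneg fun v _ => sum_nonneg fun k _ => ?_)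
    split_ifs
    exacts [heatBathProb_nonneg G β q hq σ v k, le_rfl]
  · have := sum_HB_mul G β q σ fun _ => 1
    simp only [mul_one, sum_heatBathProb G β q hq] at this
    simpa using this

/-- Recoloring one vertex changes the Swendsen–Wang transition probabilities by at most a factor
`(q e^β)^Δ`. -/
lemma SW_update_le (hq : 0 < q) (hβ : 0 ≤ β) (σ τ : V → Fin q) (v : V) (k : Fin q) :
    SW G β q (Function.update σ v k) τ ≤
      ((q : ℝ) * Real.exp β) ^ G.maxDegree * SW G β q σ τ := by
  set σ' := Function.update σ v k
  set p := 1 - Real.exp (-β) with hp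
  set r := Real.exp (-β) with hr
  have hp0 : 0 ≤ p := one_sub_exp_neg_nonneg hβ
  have hr0 : 0 < r := Real.exp_pos _
  have hr1 : r ≤ 1 := by linarith
  have hq1 : (1 : ℝ) ≤ q := by exact_mod_cast hq
  let F : Finset (Sym2 V) := {e ∈ monoEdges G σ | v ∉ e}
  have hF' : {e ∈ monoEdges G σ' | v ∉ e} = F := by
    ext e
    simp only [F, monoEdges, mem_filter, and_assoc]
    refine and_congr_right fun _ => and_congr_left fun hv => ?_
    have hne : ∀ u ∈ e, σ' u = σ u := fun u hu =>
      Function.update_of_ne (fun h : u = v => hv (h ▸ hu)) _ _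
    exact forall₂_congr fun u hu => forall₂_congr fun w hw => by rw [hne u hu, hne w hw]
  have hstar (ρ : V → Fin q) : #{e ∈ monoEdges G ρ | v ∈ e} ≤ G.maxDegree := by
    refine le_trans (card_le_card ?_) ((G.card_incidenceFinset_eq_degree v).le.trans
      (G.degree_le_maxDegree v))
    intro e he
    rw [mem_filter] at he
    rw [SimpleGraph.incidenceFinset_eq_filter, mem_filter]
    exact ⟨monoEdges_subset G q ρ he.1, he.2⟩
  let S : Finset (Sym2 V) := {e ∈ monoEdges G σ' | v ∈ e}
  have hcard' : #(monoEdges G σ') = #F + #S := by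
    rw [← hF', add_comm]
    exact (card_filter_add_card_filter_not _).symm
  have hcard : #(monoEdges G σ) ≤ #F + G.maxDegree := by
    have := card_filter_add_card_filter_not (s := monoEdges G σ) (fun e => v ∈ e)
    have := hstar σ
    change #(monoEdges G σ) ≤ #{e ∈ monoEdges G σ | v ∉ e} + _
    omega
  let D := F ∩ monoEdges G τ
  let W : ℝ := ∑ A ∈ D.powerset, p ^ #A * r ^ (#F - #A) * ((q : ℝ) ^ numComp A)⁻¹
  have lower : r ^ G.maxDegree * W ≤ SW G β q σ τ := by
    rw [mul_sum]
    have hD : D.powerset ⊆ (monoEdges G σ ∩ monoEdges G τ).powerset :=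
      powerset_mono.2 (inter_subset_inter_right (filter_subset _ _))
    refine le_trans (sum_le_sum fun A hA => ?_)
      (sum_le_sum_of_subset_of_nonneg hD fun A _ _ => by positivity)
    have hAF := card_le_card ((mem_powerset.1 hA).trans inter_subset_left)
    calc _ = p ^ #A * r ^ (G.maxDegree + (#F - #A)) * ((q : ℝ) ^ numComp A)⁻¹ := by
          rw [pow_add]; ring
      _ ≤ _ := by
          gcongr ?_ * ?_ * _
          exact pow_le_pow_of_le_one hr0.le hr1 (by omega)
  have upper : SW G β q σ' τ ≤ (q : ℝ) ^ G.maxDegree * W := by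
    have hdisj {A B : Finset (Sym2 V)} (hA : A ⊆ D) (hB : B ⊆ S) : Disjoint A B := by
      rw [disjoint_left]
      intro e heA heB
      exact (mem_filter.1 (inter_subset_left (hA heA))).2 (mem_filter.1 (hB heB)).2
    calc SW G β q σ' τ ≤ ∑ x ∈ D.powerset ×ˢ S.powerset,
          (q : ℝ) ^ G.maxDegree * ((p ^ #x.1 * r ^ (#F - #x.1) * ((q : ℝ) ^ numComp x.1)⁻¹) *
            (p ^ #x.2 * r ^ (#S - #x.2))) := by
          let i : Finset (Sym2 V) → Finset (Sym2 V) × Finset (Sym2 V) :=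
            fun A => ({e ∈ A | v ∉ e}, {e ∈ A | v ∈ e})
          have hi : Set.InjOn i ↑(monoEdges G σ' ∩ monoEdges G τ).powerset := by
            intro A _ B _ hAB
            simp only [i, Prod.mk.injEq] at hAB
            rw [← filter_union_filter_not_eq (fun e => v ∈ e) A, hAB.1, hAB.2,
              filter_union_filter_not_eq]
          have himg : (monoEdges G σ' ∩ monoEdges G τ).powerset.image i ⊆
              D.powerset ×ˢ S.powerset := by
            rintro _ hx
            obtain ⟨A, hA, rfl⟩ := mem_image.1 hx
            obtain ⟨h1, h2⟩ := subset_inter_iff.1 (mem_powerset.1 hA)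
            refine mem_product.2 ⟨mem_powerset.2 (subset_inter ?_ ?_), mem_powerset.2 ?_⟩
            · rw [← hF']; exact filter_subset_filter _ h1
            · exact (filter_subset _ _).trans h2
            · exact filter_subset_filter _ h1
          refine le_trans ?_ (sum_le_sum_of_subset_of_nonneg himg fun x _ _ => by positivity)
          rw [sum_image hi, SW]
          refine sum_le_sum fun A hA => ?_
          obtain ⟨hx1, hx2⟩ := mem_product.1 (himg (mem_image_of_mem i hA))
          rw [mem_powerset] at hx1 hx2
          have hunion : (i A).1 ∪ (i A).2 = A := by
            rw [union_comm]; exact filter_union_filter_not_eq _ A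
          set A₁ := (i A).1
          set A₂ := (i A).2
          have hc1 := card_le_card (hx1.trans inter_subset_left)
          have hc2 := card_le_card hx2
          have hcA : #A = #A₁ + #A₂ := by rw [← hunion, card_union_of_disjoint (hdisj hx1 hx2)]
          have hcomp : numComp A₁ ≤ numComp A + G.maxDegree := by
            have := numComp_le_union A₁ A₂
            rw [hunion] at this
            have := hstar σ'
            change #S ≤ _ at this
            omega
          have hqq : ((q : ℝ) ^ numComp A)⁻¹ ≤
              (q : ℝ) ^ G.maxDegree * ((q : ℝ) ^ numComp A₁)⁻¹ := by
            rw [← div_eq_mul_inv, le_div_iff₀ (by positivity), inv_mul_le_iff₀ (by positivity),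
              ← pow_add]
            exact pow_le_pow_right₀ hq1 hcomp
          have hrr : r ^ (#(monoEdges G σ') - #A) = r ^ (#F - #A₁) * r ^ (#S - #A₂) := by
            rw [← pow_add]
            congr 1
            omega
          change p ^ #A * r ^ (#(monoEdges G σ') - #A) * _ ≤ _
          rw [hrr, hcA, pow_add]
          refine (mul_le_mul_of_nonneg_left hqq (by positivity)).trans (le_of_eq ?_)
          ring
      _ = _ := by
          rw [← mul_sum, sum_product, ← sum_mul_sum D.powerset S.powerset
            (fun A => p ^ #A * r ^ (#F - #A) * ((q : ℝ) ^ numComp A)⁻¹)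
            (fun B => p ^ #B * r ^ (#S - #B)), sum_pow_mul_eq_add_pow,
            show p + r = 1 by simp [hp], one_pow, mul_one]
  have hrinv : Real.exp β * r = 1 := by rw [hr, ← Real.exp_add]; simp
  calc _ ≤ (q : ℝ) ^ G.maxDegree * W := upper
    _ = ((q : ℝ) * Real.exp β) ^ G.maxDegree * (r ^ G.maxDegree * W) := by
        rw [← mul_assoc, ← mul_pow, mul_assoc (q : ℝ), hrinv, mul_one]
    _ ≤ _ := mul_le_mul_of_nonneg_left lower (by positivity)

lemma HB_matMul_SW_le [Nonempty V] (hq : 0 < q) (hβ : 0 ≤ β) (σ τ : V → Fin q) :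
    matMul (HB G β q) (SW G β q) σ τ ≤
      ((q : ℝ) * Real.exp β) ^ G.maxDegree * SW G β q σ τ := by
  set M := ((q : ℝ) * Real.exp β) ^ G.maxDegree * SW G β q σ τ
  calc _ = (Fintype.card V : ℝ)⁻¹ * ∑ v, ∑ k,
        heatBathProb G β q σ v k * SW G β q (Function.update σ v k) τ :=
        sum_HB_mul G β q σ fun ρ => SW G β q ρ τ
    _ ≤ (Fintype.card V : ℝ)⁻¹ * ∑ v, ∑ k, heatBathProb G β q σ v k * M := by
        gcongr with v _ k _
        · exact heatBathProb_nonneg G β q hq σ v k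
        · exact SW_update_le G q hq hβ σ τ v k
    _ = M := by
        simp only [← sum_mul, sum_heatBathProb G β q hq]
        simp

end Potts

/-- Theorem 1 of Ullrich, *Comparison of Swendsen-Wang and Heat-Bath Dynamics*:
the spectral gap of the Swendsen–Wang dynamics is at least
`c_SW = (2q²)⁻¹ (q e^{2β})^{-4Δ}` times the spectral gap of the heat-bath dynamics. -/
theorem swendsen_wang_gap_ge_heat_bath_gap
    {V : Type*} [Fintype V] [DecidableEq V] [Nonempty V]
    (G : SimpleGraph V) [DecidableRel G.Adj]
    (q : ℕ) (hq : 2 ≤ q) (β : ℝ) (hβ : 0 ≤ β) :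
    specGap (potts G β q) (SW G β q) ≥
      (1 / (2 * (q : ℝ) ^ 2)) * ((q : ℝ) * Real.exp (2 * β)) ^ (-(4 * (G.maxDegree : ℤ))) *
        specGap (potts G β q) (HB G β q) := by
  have hq0 : 0 < q := by omega
  have hq1 : (1 : ℝ) ≤ q := by exact_mod_cast hq0
  have hexp : 1 ≤ Real.exp β := Real.one_le_exp hβ
  have hexp2 : Real.exp β ≤ Real.exp (2 * β) := Real.exp_le_exp.2 (by linarith)
  have hbase : 1 ≤ (q : ℝ) * Real.exp β := one_le_mul_of_one_le_of_one_le hq1 hexp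
  have hbase2 : (q : ℝ) * Real.exp β ≤ q * Real.exp (2 * β) := by gcongr
  obtain ⟨hgap, hle⟩ := specGap_ge_of_matMul_le (fun σ => (potts_pos G β q hq0 σ).le)
    (sum_potts G β q hq0) (SW_isStationaryKernel G q hq0 hβ) (HB_isStationaryKernel G q hq0)
    (SW_reversible G β q) (SW_posSemidef G q hq0 hβ) (one_le_pow₀ hbase)
    (HB_matMul_SW_le G q hq0 hβ)
  refine ge_iff_le.2 (le_trans (mul_le_mul_of_nonneg_right ?_ hgap) hle)
  have hpow : ((q : ℝ) * Real.exp (2 * β)) ^ (-(4 * (G.maxDegree : ℤ))) =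
      (((q : ℝ) * Real.exp (2 * β)) ^ (4 * G.maxDegree))⁻¹ := by
    rw [zpow_neg]
    norm_cast
  have hconst : 1 / (2 * (q : ℝ) ^ 2) ≤ 1 := by
    rw [div_le_one (by positivity)]
    nlinarith
  rw [hpow]
  calc _ ≤ 1 * (((q : ℝ) * Real.exp (2 * β)) ^ (4 * G.maxDegree))⁻¹ := by gcongr
    _ ≤ (((q : ℝ) * Real.exp β) ^ G.maxDegree)⁻¹ := by
        rw [one_mul]
        refine inv_anti₀ (by positivity) ?_
        calc _ ≤ ((q : ℝ) * Real.exp (2 * β)) ^ G.maxDegree := by gcongr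
          _ ≤ _ := pow_le_pow_right₀ (hbase.trans hbase2) (by omega)

end
end

section
/- Let Ω₁ and Ω₂ be finite sets, let π and μ be fully supported probability distributions on Ω₁ and Ω₂ respectively, let T be a stochastic matrix indexed by Ω₁ × Ω₂ with Σ_{x∈Ω₁} π(x)·T(x,y) = μ(y) for all y ∈ Ω₂, and let T* be its adjoint, T*(y,x) = π(x)·T(x,y)/μ(y). Let B be a stochastic matrix on Ω₂ that is reversible with respect to μ. Then M = T·B·T* is a stochastic matrix on Ω₁ reversible with respect to π, and ‖M − S_π‖_π ≤ ‖B − S_μ‖_μ · ‖T*·T − S_μ‖_μ; in particular λ(M) ≥ max{1 − ‖B − S_μ‖_μ, λ(T*·T)}. (This is the abstract form of the statement that the modified Swendsen–Wang dynamics M = T_{G,p,q} D T*_{G_D,p*,q} T_{G_D,p*,q} D* T*_{G,p,q} on a planar graph G has spectral gap λ(M) ≥ max{λ(P^G_{β,q}), λ(P^{G_D}_{β*,q})}.) -/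
open Finset

noncomputable section

open scoped Matrix

section ConstRow

variable {α β γ : Type*}

/-- The rectangular matrix `S_ν`, all of whose rows equal `ν`. -/
def constRow {β : Type*} (α : Type*) (ν : β → ℝ) : Matrix α β ℝ := fun _ y => ν y

lemma mul_constRow [Fintype β] {P : Matrix α β ℝ} (hP : ∀ x, ∑ y, P x y = 1) (ν : γ → ℝ) :
    P * constRow β ν = constRow α ν := by
  ext x z
  simp [Matrix.mul_apply, constRow, ← sum_mul, hP]

lemma constRow_mul [Fintype α] {P : Matrix α β ℝ} {ν : α → ℝ} {μ : β → ℝ}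
    (hP : ∀ y, ∑ x, ν x * P x y = μ y) : constRow γ ν * P = constRow γ μ := by
  ext z y
  simp [Matrix.mul_apply, constRow, hP]

lemma sum_mul_apply_eq_one [Fintype β] [Fintype γ] {P : Matrix α β ℝ} {Q : Matrix β γ ℝ}
    (hP : ∀ x, ∑ y, P x y = 1) (hQ : ∀ y, ∑ z, Q y z = 1) (x : α) :
    ∑ z, (P * Q) x z = 1 := by
  simp only [Matrix.mul_apply]
  rw [sum_comm]
  simp only [← mul_sum, hQ, mul_one, hP]

lemma sum_mul_mul_apply [Fintype α] [Fintype β] {P : Matrix α β ℝ} {Q : Matrix β γ ℝ}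
    {ν : α → ℝ} {μ : β → ℝ} {ρ : γ → ℝ} (hP : ∀ y, ∑ x, ν x * P x y = μ y)
    (hQ : ∀ z, ∑ y, μ y * Q y z = ρ z) (z : γ) :
    ∑ x, ν x * (P * Q) x z = ρ z := by
  simp only [Matrix.mul_apply, mul_sum, ← mul_assoc]
  rw [sum_comm]
  simp only [← sum_mul, hP, hQ]

end ConstRow

section WeightedL2

variable {α β : Type*} [Fintype α] [Fintype β]

lemma l2norm_nonneg (ν : α → ℝ) (f : α → ℝ) : 0 ≤ l2norm ν f := Real.sqrt_nonneg _

lemma l2norm_sq {ν : α → ℝ} (hν : ∀ x, 0 < ν x) (f : α → ℝ) :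
    l2norm ν f ^ 2 = ∑ x, f x ^ 2 * ν x :=
  Real.sq_sqrt (sum_nonneg fun x _ => mul_nonneg (sq_nonneg _) (hν x).le)

lemma l2norm_smul (ν : α → ℝ) {c : ℝ} (hc : 0 ≤ c) (f : α → ℝ) :
    l2norm ν (c • f) = c * l2norm ν f := by
  have h : ∑ x, (c • f) x ^ 2 * ν x = c ^ 2 * ∑ x, f x ^ 2 * ν x := by
    rw [mul_sum]
    exact sum_congr rfl fun x _ => by simp only [Pi.smul_apply, smul_eq_mul]; ring
  rw [l2norm, l2norm, h, Real.sqrt_mul (sq_nonneg c), Real.sqrt_sq hc]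

/-- Cauchy–Schwarz in `L₂(ν)`. -/
lemma sum_mul_le_l2norm_mul {ν : α → ℝ} (hν : ∀ x, 0 < ν x) (f g : α → ℝ) :
    ∑ x, f x * g x * ν x ≤ l2norm ν f * l2norm ν g := by
  refine le_of_sq_le_sq ?_ (mul_nonneg (l2norm_nonneg _ _) (l2norm_nonneg _ _))
  rw [mul_pow, l2norm_sq hν, l2norm_sq hν]
  exact sum_sq_le_sum_mul_sum_of_sq_le_mul _ (fun x _ => mul_nonneg (sq_nonneg _) (hν x).le)
    (fun x _ => mul_nonneg (sq_nonneg _) (hν x).le) fun x _ => le_of_eq (by ring)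

lemma opNorm_nonneg_s6 (ν : α → ℝ) (A : Matrix α α ℝ) : 0 ≤ opNorm ν A := by
  refine Real.sSup_nonneg ?_
  rintro _ ⟨f, -, rfl⟩
  exact l2norm_nonneg _ _

lemma opNorm_le_s6 {ν : α → ℝ} {A : Matrix α α ℝ} {C : ℝ} (hC : 0 ≤ C)
    (h : ∀ f, l2norm ν (A *ᵥ f) ≤ C * l2norm ν f) : opNorm ν A ≤ C := by
  refine Real.sSup_le ?_ hC
  rintro _ ⟨f, hf, rfl⟩
  exact (h f).trans (mul_le_of_le_one_right hC hf)

lemma l2norm_mulVec_le_opNorm {ν : α → ℝ} {A : Matrix α α ℝ} {C : ℝ} (hC : 0 ≤ C)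
    (h : ∀ f, l2norm ν (A *ᵥ f) ≤ C * l2norm ν f) (f : α → ℝ) :
    l2norm ν (A *ᵥ f) ≤ opNorm ν A * l2norm ν f := by
  rcases (l2norm_nonneg ν f).eq_or_lt with h0 | hpos
  · simpa [← h0] using h f
  have hbdd : BddAbove {r : ℝ | ∃ f : α → ℝ,
      l2norm ν f ≤ 1 ∧ r = l2norm ν fun x => ∑ y, A x y * f y} := by
    refine ⟨C, ?_⟩
    rintro _ ⟨g, hg, rfl⟩
    exact (h g).trans (mul_le_of_le_one_right hC hg)
  have hinv := inv_nonneg.2 hpos.le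
  have key : l2norm ν (A *ᵥ ((l2norm ν f)⁻¹ • f)) ≤ opNorm ν A :=
    le_csSup hbdd ⟨(l2norm ν f)⁻¹ • f,
      by rw [l2norm_smul _ hinv, inv_mul_cancel₀ hpos.ne'], rfl⟩
  rw [Matrix.mulVec_smul, l2norm_smul _ hinv] at key
  rwa [inv_mul_le_iff₀ hpos, mul_comm] at key

/-- If `V` is the adjoint of `U`, then `‖U A V‖ ≤ ‖A‖ ‖V U‖`. -/
lemma opNorm_mul_mul_adjoint_le {π : α → ℝ} {μ : β → ℝ}
    (hπ : ∀ x, 0 < π x) (hμ : ∀ y, 0 < μ y) {U : Matrix α β ℝ} {V : Matrix β α ℝ}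
    (hUV : ∀ x y, π x * U x y = μ y * V y x) {A : Matrix β β ℝ} {a c : ℝ}
    (ha : 0 ≤ a) (hA : ∀ f, l2norm μ (A *ᵥ f) ≤ a * l2norm μ f)
    (hc : 0 ≤ c) (hVU : ∀ f, l2norm μ ((V * U) *ᵥ f) ≤ c * l2norm μ f) :
    opNorm π (U * A * V) ≤ a * c := by
  have adj (g : β → ℝ) (h : α → ℝ) :
      ∑ x, (U *ᵥ g) x * h x * π x = ∑ y, g y * (V *ᵥ h) y * μ y := by
    simp only [Matrix.mulVec, dotProduct, sum_mul, mul_sum]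
    rw [sum_comm]
    refine sum_congr rfl fun y _ => sum_congr rfl fun x _ => ?_
    linear_combination (g y * h x) * hUV x y
  have hU (g : β → ℝ) : l2norm π (U *ᵥ g) ≤ √c * l2norm μ g := by
    refine le_of_sq_le_sq ?_ (mul_nonneg (Real.sqrt_nonneg _) (l2norm_nonneg _ _))
    calc l2norm π (U *ᵥ g) ^ 2 = ∑ y, g y * ((V * U) *ᵥ g) y * μ y := by
          rw [l2norm_sq hπ, ← Matrix.mulVec_mulVec, ← adj]
          exact sum_congr rfl fun x _ => by rw [sq]
      _ ≤ l2norm μ g * l2norm μ ((V * U) *ᵥ g) := sum_mul_le_l2norm_mul hμ _ _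
      _ ≤ l2norm μ g * (c * l2norm μ g) :=
          mul_le_mul_of_nonneg_left (hVU g) (l2norm_nonneg _ _)
      _ = (√c * l2norm μ g) ^ 2 := by rw [mul_pow, Real.sq_sqrt hc]; ring
  have hV (h : α → ℝ) : l2norm μ (V *ᵥ h) ≤ √c * l2norm π h := by
    rcases (l2norm_nonneg μ (V *ᵥ h)).eq_or_lt with h0 | hpos
    · rw [← h0]
      exact mul_nonneg (Real.sqrt_nonneg _) (l2norm_nonneg _ _)
    refine le_of_mul_le_mul_right ?_ hpos
    calc l2norm μ (V *ᵥ h) * l2norm μ (V *ᵥ h)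
        = ∑ x, (U *ᵥ (V *ᵥ h)) x * h x * π x := by
          rw [adj, ← sq, l2norm_sq hμ]
          exact sum_congr rfl fun x _ => by rw [sq]
      _ ≤ l2norm π (U *ᵥ (V *ᵥ h)) * l2norm π h := sum_mul_le_l2norm_mul hπ _ _
      _ ≤ √c * l2norm μ (V *ᵥ h) * l2norm π h :=
          mul_le_mul_of_nonneg_right (hU _) (l2norm_nonneg _ _)
      _ = √c * l2norm π h * l2norm μ (V *ᵥ h) := by ring
  refine opNorm_le_s6 (mul_nonneg ha hc) fun f => ?_
  rw [← Matrix.mulVec_mulVec, ← Matrix.mulVec_mulVec]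
  calc l2norm π (U *ᵥ (A *ᵥ (V *ᵥ f)))
      ≤ √c * (a * (√c * l2norm π f)) := (hU _).trans <|
        mul_le_mul_of_nonneg_left ((hA _).trans (mul_le_mul_of_nonneg_left (hV f) ha))
          (Real.sqrt_nonneg _)
    _ = a * c * l2norm π f := by linear_combination (a * l2norm π f) * Real.mul_self_sqrt hc

/-- A stochastic matrix with stationary distribution `ν`, minus `S_ν`, is a contraction. -/
lemma l2norm_sub_constRow_mulVec_le {ν : α → ℝ} (hν : ∀ x, 0 < ν x) (hsum : ∑ x, ν x = 1)
    {P : Matrix α α ℝ} (hP0 : ∀ x y, 0 ≤ P x y) (hP1 : ∀ x, ∑ y, P x y = 1)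
    (hP : ∀ y, ∑ x, ν x * P x y = ν y) (f : α → ℝ) :
    l2norm ν ((P - constRow α ν) *ᵥ f) ≤ 1 * l2norm ν f := by
  rw [one_mul]
  refine le_of_sq_le_sq ?_ (l2norm_nonneg _ _)
  rw [l2norm_sq hν, l2norm_sq hν]
  have stat (g : α → ℝ) : ∑ x, (P *ᵥ g) x * ν x = ∑ y, g y * ν y := by
    simp only [Matrix.mulVec, dotProduct, sum_mul]
    rw [sum_comm]
    refine sum_congr rfl fun y _ => ?_
    rw [← hP y, mul_sum]
    exact sum_congr rfl fun x _ => by ring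
  have jensen (x : α) : (P *ᵥ f) x ^ 2 ≤ (P *ᵥ fun y => f y ^ 2) x := by
    have h := sum_sq_le_sum_mul_sum_of_sq_le_mul univ (r := fun y => P x y * f y)
      (f := fun y => P x y) (g := fun y => P x y * f y ^ 2) (fun y _ => hP0 x y)
      (fun y _ => mul_nonneg (hP0 x y) (sq_nonneg _)) fun y _ => le_of_eq (by ring)
    rwa [hP1, one_mul] at h
  have hS (x : α) : ((P - constRow α ν) *ᵥ f) x = (P *ᵥ f) x - ∑ y, f y * ν y := by
    rw [Matrix.sub_mulVec, Pi.sub_apply]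
    congr 1
    exact sum_congr rfl fun y _ => mul_comm _ _
  set m := ∑ y, f y * ν y with hm
  calc ∑ x, ((P - constRow α ν) *ᵥ f) x ^ 2 * ν x
      = ∑ x, ((P *ᵥ f) x ^ 2 * ν x - 2 * m * ((P *ᵥ f) x * ν x) + m ^ 2 * ν x) :=
        sum_congr rfl fun x _ => by rw [hS]; ring
    _ = ∑ x, (P *ᵥ f) x ^ 2 * ν x - m ^ 2 := by
        rw [sum_add_distrib, sum_sub_distrib, ← mul_sum, ← mul_sum, stat, ← hm, hsum]
        ring
    _ ≤ ∑ x, (P *ᵥ f) x ^ 2 * ν x := sub_le_self _ (sq_nonneg m)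
    _ ≤ ∑ x, (P *ᵥ fun y => f y ^ 2) x * ν x :=
        sum_le_sum fun x _ => mul_le_mul_of_nonneg_right (jensen x) (hν x).le
    _ = ∑ x, f x ^ 2 * ν x := stat _

end WeightedL2

/-- abstract form of Proposition on the modified Swendsen–Wang dynamics:
if `T` is a stochastic matrix carrying `π` to `μ`, `T*` its adjoint, and `B` a stochastic
matrix reversible w.r.t. `μ`, then `M = T·B·T*` is stochastic, reversible w.r.t. `π`, and
`‖M - S_π‖_π ≤ ‖B - S_μ‖_μ · ‖T*·T - S_μ‖_μ`; in particular
`λ(M) ≥ max {1 - ‖B - S_μ‖_μ, λ(T*·T)}`. -/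
theorem modified_swendsen_wang_gap
    {Ω₁ Ω₂ : Type*} [Fintype Ω₁] [Fintype Ω₂]
    (π : Ω₁ → ℝ) (μ : Ω₂ → ℝ)
    (hπpos : ∀ x, 0 < π x) (hπsum : ∑ x, π x = 1)
    (hμpos : ∀ y, 0 < μ y) (hμsum : ∑ y, μ y = 1)
    (T : Ω₁ → Ω₂ → ℝ) (hT0 : ∀ x y, 0 ≤ T x y) (hT1 : ∀ x, ∑ y, T x y = 1)
    (hTμ : ∀ y, ∑ x, π x * T x y = μ y)
    (B : Ω₂ → Ω₂ → ℝ) (hB0 : ∀ y y', 0 ≤ B y y') (hB1 : ∀ y, ∑ y', B y y' = 1)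
    (hBrev : ∀ y y', μ y * B y y' = μ y' * B y' y)
    (Tstar : Ω₂ → Ω₁ → ℝ) (hTstar : ∀ y x, Tstar y x = π x * T x y / μ y)
    (M : Ω₁ → Ω₁ → ℝ) (hM : ∀ x x', M x x' = ∑ y, ∑ y', T x y * B y y' * Tstar y' x') :
    (∀ x x', 0 ≤ M x x') ∧ (∀ x, ∑ x', M x x' = 1) ∧
    (∀ x x', π x * M x x' = π x' * M x' x) ∧
    opNorm π (fun x x' => M x x' - π x') ≤
      opNorm μ (fun y y' => B y y' - μ y') *
        opNorm μ (fun y y' => (∑ x, Tstar y x * T x y') - μ y') ∧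
    specGap π M ≥ max (1 - opNorm μ (fun y y' => B y y' - μ y'))
      (specGap μ fun y y' => ∑ x, Tstar y x * T x y') := by
  have hadj (x y) : μ y * Tstar y x = π x * T x y := by
    rw [hTstar, mul_div_cancel₀ _ (hμpos y).ne']
  have hTs0 (y x) : 0 ≤ Tstar y x := by
    rw [hTstar]
    exact div_nonneg (mul_nonneg (hπpos x).le (hT0 x y)) (hμpos y).le
  have hTs1 (y) : ∑ x, Tstar y x = 1 := by
    simp only [hTstar]
    rw [← sum_div, hTμ, div_self (hμpos y).ne']
  have hTsπ (x) : ∑ y, μ y * Tstar y x = π x := by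
    simp only [hadj, ← mul_sum, hT1, mul_one]
  have hBμ (y') : ∑ y, μ y * B y y' = μ y' := by
    simp only [hBrev _ y', ← mul_sum, hB1, mul_one]
  let T' : Matrix Ω₁ Ω₂ ℝ := T
  let B' : Matrix Ω₂ Ω₂ ℝ := B
  let V' : Matrix Ω₂ Ω₁ ℝ := Tstar
  let M' : Matrix Ω₁ Ω₁ ℝ := M
  have hM' : M' = T' * B' * V' := by
    ext x x'
    rw [Matrix.mul_apply]
    simp only [Matrix.mul_apply, sum_mul]
    exact (hM x x').trans sum_comm
  have hTB1 := sum_mul_apply_eq_one (P := T') (Q := B') hT1 hB1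
  have hK0 (y y') : 0 ≤ (V' * T') y y' :=
    sum_nonneg fun x _ => mul_nonneg (hTs0 y x) (hT0 x y')
  have hK1 := sum_mul_apply_eq_one (P := V') (Q := T') hTs1 hT1
  have hKμ := sum_mul_mul_apply (P := V') (Q := T') hTsπ hTμ
  have hA := l2norm_sub_constRow_mulVec_le hμpos hμsum (P := B') hB0 hB1 hBμ
  have hK := l2norm_sub_constRow_mulVec_le hμpos hμsum hK0 hK1 hKμ
  have hUV (x y) : π x * (T' - constRow Ω₁ μ) x y = μ y * (V' - constRow Ω₂ π) y x := by
    change π x * (T x y - μ y) = μ y * (Tstar y x - π x)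
    linear_combination -hadj x y
  have hμ1 : constRow Ω₁ μ * constRow Ω₂ π = constRow Ω₁ π :=
    constRow_mul fun x => by simp [constRow, ← sum_mul, hμsum]
  have hVU : (V' - constRow Ω₂ π) * (T' - constRow Ω₁ μ) = V' * T' - constRow Ω₂ μ := by
    rw [Matrix.sub_mul, Matrix.mul_sub, Matrix.mul_sub, mul_constRow (P := V') hTs1,
      constRow_mul (P := T') hTμ, constRow_mul (P := constRow Ω₁ μ) (μ := μ)
        fun x => by simp [constRow, ← sum_mul, hπsum]]
    abel
  have hUAV : (T' - constRow Ω₁ μ) * (B' - constRow Ω₂ μ) * (V' - constRow Ω₂ π) =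
      M' - constRow Ω₁ π := by
    have h : (T' - constRow Ω₁ μ) * (B' - constRow Ω₂ μ) = T' * B' - constRow Ω₁ μ := by
      rw [Matrix.sub_mul, Matrix.mul_sub, Matrix.mul_sub, mul_constRow (P := T') hT1,
        constRow_mul (P := B') hBμ, constRow_mul (P := constRow Ω₂ μ) (μ := μ)
          fun x => by simp [constRow, ← sum_mul, hμsum]]
      abel
    rw [h, Matrix.sub_mul, Matrix.mul_sub, Matrix.mul_sub, mul_constRow hTB1,
      constRow_mul (P := V') hTsπ, hμ1, hM']
    abel
  have hmain : opNorm π (M' - constRow Ω₁ π) ≤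
      opNorm μ (B' - constRow Ω₂ μ) * opNorm μ (V' * T' - constRow Ω₂ μ) := by
    rw [← hUAV]
    refine opNorm_mul_mul_adjoint_le hπpos hμpos hUV (opNorm_nonneg_s6 _ _)
      (l2norm_mulVec_le_opNorm zero_le_one hA) (opNorm_nonneg_s6 _ _) ?_
    rw [hVU]
    exact l2norm_mulVec_le_opNorm zero_le_one hK
  refine ⟨fun x x' => ?_, fun x => ?_, fun x x' => ?_, hmain, max_le ?_ ?_⟩
  · rw [hM]
    exact sum_nonneg fun y _ => sum_nonneg fun y' _ =>
      mul_nonneg (mul_nonneg (hT0 x y) (hB0 y y')) (hTs0 y' x')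
  · change ∑ x', M' x x' = 1
    rw [hM']
    exact sum_mul_apply_eq_one hTB1 hTs1 x
  · rw [hM, hM, mul_sum, mul_sum]
    simp only [mul_sum]
    rw [sum_comm]
    refine sum_congr rfl fun y' _ => sum_congr rfl fun y _ => ?_
    linear_combination (-B y y' * Tstar y' x') * hadj x y +
      Tstar y x * Tstar y' x' * hBrev y y' + (B y' y * Tstar y x) * hadj x' y'
  · exact sub_le_sub_left (hmain.trans
      (mul_le_of_le_one_right (opNorm_nonneg_s6 _ _) (opNorm_le_s6 zero_le_one hK))) 1
  · exact sub_le_sub_left (hmain.trans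
      (mul_le_of_le_one_left (opNorm_nonneg_s6 _ _) (opNorm_le_s6 zero_le_one hA))) 1

end
end

section
/- Let G = (V,E) be a finite simple graph and G₀ = (V,E₀) a spanning subgraph with E₀ ⊆ E. Then for all σ,τ ∈ Ω_P, c₁^{|E∖E₀|}·P_{G₀}(σ,τ) ≤ P_G(σ,τ) ≤ c₂^{|E∖E₀|}·P_{G₀}(σ,τ), where c₁ = e^{−β} and c₂ = 1 + q·(e^{β} − 1), and P_G, P_{G₀} denote the Swendsen–Wang transition matrices on (V,E) and (V,E₀) respectively (both acting on Ω_P = [q]^V). -/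
open Finset

noncomputable section

/-- Adding one edge merges at most two connected components. -/
theorem numComp_le_numComp_insert_add_one {V : Type*} [Finite V] [DecidableEq V]
    (e : Sym2 V) (A : Finset (Sym2 V)) : numComp A ≤ numComp (insert e A) + 1 := by
  classical
  induction e using Sym2.ind with
  | _ u v =>
  set H := SimpleGraph.fromEdgeSet (↑A : Set (Sym2 V)) with hH
  set K := SimpleGraph.fromEdgeSet (↑(insert s(u, v) A) : Set (Sym2 V)) with hK
  let f : V → H.ConnectedComponent := fun w =>
    if H.connectedComponentMk w = H.connectedComponentMk u then H.connectedComponentMk v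
    else H.connectedComponentMk w
  have f_left : f u = H.connectedComponentMk v := by simp [f]
  have f_right : f v = H.connectedComponentMk v := by simp [f]
  have f_adj : ∀ x y, K.Adj x y → f x = f y := by
    intro x y hxy
    rw [hK, SimpleGraph.fromEdgeSet_adj, Finset.mem_coe, Finset.mem_insert] at hxy
    obtain ⟨hxy | hxy, hne⟩ := hxy
    · rcases Sym2.eq_iff.mp hxy with ⟨rfl, rfl⟩ | ⟨rfl, rfl⟩
      · rw [f_left, f_right]
      · rw [f_left, f_right]
    · have hadj : H.Adj x y := by
        rw [hH, SimpleGraph.fromEdgeSet_adj]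
        exact ⟨hxy, hne⟩
      have hcomp : H.connectedComponentMk x = H.connectedComponentMk y :=
        SimpleGraph.ConnectedComponent.sound hadj.reachable
      simp only [f, hcomp]
  have f_walk : ∀ x y (w : K.Walk x y), f x = f y := by
    intro x y w
    induction w with
    | nil => rfl
    | cons h _ ih => exact (f_adj _ _ h).trans ih
  let g : Option K.ConnectedComponent → H.ConnectedComponent := fun o =>
    o.elim (H.connectedComponentMk u)
      (SimpleGraph.ConnectedComponent.lift f fun x y w _ => f_walk x y w)
  have g_surj : Function.Surjective g := by
    intro c
    induction c using SimpleGraph.ConnectedComponent.ind with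
    | _ x =>
    by_cases hx : H.connectedComponentMk x = H.connectedComponentMk u
    · exact ⟨none, hx.symm⟩
    · refine ⟨some (K.connectedComponentMk x), ?_⟩
      change f x = _
      simp only [f, if_neg hx]
  calc numComp A = Nat.card H.ConnectedComponent := rfl
    _ ≤ Nat.card (Option K.ConnectedComponent) := Nat.card_le_card_of_surjective g g_surj
    _ = numComp (insert s(u, v) A) + 1 := Finite.card_option

/-- The random-cluster partition function `∑_{A ⊆ S} x^|A| q^{-C(A)}`. -/
def clusterSum {V : Type*} (x : ℝ) (q : ℕ) (S : Finset (Sym2 V)) : ℝ :=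
  ∑ A ∈ S.powerset, x ^ A.card * ((q : ℝ) ^ numComp A)⁻¹

theorem clusterSum_nonneg {V : Type*} {x : ℝ} (hx : 0 ≤ x) (q : ℕ) (S : Finset (Sym2 V)) :
    0 ≤ clusterSum x q S :=
  Finset.sum_nonneg fun _ _ => by positivity

theorem clusterSum_mono {V : Type*} {x : ℝ} (hx : 0 ≤ x) (q : ℕ) {S T : Finset (Sym2 V)}
    (hST : S ⊆ T) : clusterSum x q S ≤ clusterSum x q T :=
  Finset.sum_le_sum_of_subset_of_nonneg (Finset.powerset_mono.mpr hST)
    fun _ _ _ => by positivity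

theorem clusterSum_insert_le {V : Type*} [Finite V] [DecidableEq V] {x : ℝ} (hx : 0 ≤ x)
    {q : ℕ} (hq : 1 ≤ q) {e : Sym2 V} {S : Finset (Sym2 V)} (he : e ∉ S) :
    clusterSum x q (insert e S) ≤ (1 + q * x) * clusterSum x q S := by
  have hq' : (1 : ℝ) ≤ q := by exact_mod_cast hq
  have hq0 : (0 : ℝ) < q := by linarith
  rw [clusterSum, Finset.sum_powerset_insert he, add_mul, one_mul]
  refine add_le_add le_rfl ?_
  rw [clusterSum, Finset.mul_sum]
  refine Finset.sum_le_sum fun A hA => ?_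
  have heA : e ∉ A := fun h => he (Finset.mem_powerset.mp hA h)
  have hinv : ((q : ℝ) ^ numComp (insert e A))⁻¹ ≤ q * ((q : ℝ) ^ numComp A)⁻¹ := by
    rw [← div_eq_mul_inv, inv_le_comm₀ (by positivity) (by positivity), inv_div,
      div_le_iff₀ hq0, ← pow_succ]
    exact pow_le_pow_right₀ hq' (numComp_le_numComp_insert_add_one e A)
  rw [Finset.card_insert_of_notMem heA]
  calc x ^ (A.card + 1) * ((q : ℝ) ^ numComp (insert e A))⁻¹
      ≤ x ^ (A.card + 1) * (q * ((q : ℝ) ^ numComp A)⁻¹) := by gcongr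
    _ = q * x * (x ^ A.card * ((q : ℝ) ^ numComp A)⁻¹) := by ring

theorem clusterSum_union_le {V : Type*} [Finite V] [DecidableEq V] {x : ℝ} (hx : 0 ≤ x)
    {q : ℕ} (hq : 1 ≤ q) {S D : Finset (Sym2 V)} (hSD : Disjoint D S) :
    clusterSum x q (D ∪ S) ≤ (1 + q * x) ^ D.card * clusterSum x q S := by
  induction D using Finset.induction_on with
  | empty => simp
  | insert e D he ih =>
    rw [Finset.disjoint_insert_left] at hSD
    have heDS : e ∉ D ∪ S := by simp [he, hSD.1]
    rw [Finset.insert_union, Finset.card_insert_of_notMem he, pow_succ', mul_assoc]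
    exact (clusterSum_insert_le hx hq heDS).trans
      (mul_le_mul_of_nonneg_left (ih hSD.2) (by positivity))

theorem SW_eq_clusterSum {V : Type*} [Fintype V] [DecidableEq V] (G : SimpleGraph V)
    [DecidableRel G.Adj] (β : ℝ) (q : ℕ) (σ τ : V → Fin q) :
    SW G β q σ τ = Real.exp (-β) ^ (monoEdges G σ).card *
      clusterSum (Real.exp β - 1) q (monoEdges G σ ∩ monoEdges G τ) := by
  rw [SW, clusterSum, Finset.mul_sum]
  refine Finset.sum_congr rfl fun A hA => ?_
  have hcard : A.card ≤ (monoEdges G σ).card :=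
    Finset.card_le_card ((Finset.mem_powerset.mp hA).trans Finset.inter_subset_left)
  have hp : 1 - Real.exp (-β) = Real.exp (-β) * (Real.exp β - 1) := by
    rw [mul_sub, ← Real.exp_add]
    simp
  rw [hp, mul_pow, ← Nat.sub_add_cancel hcard, pow_add, Nat.add_sub_cancel]
  ring

/-- Lemma 3: for a spanning subgraph `G₀ ≤ G`,
`c₁^{|E∖E₀|}·P_{G₀}(σ,τ) ≤ P_G(σ,τ) ≤ c₂^{|E∖E₀|}·P_{G₀}(σ,τ)` with
`c₁ = e^{-β}` and `c₂ = 1 + q(e^β - 1)`. -/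
theorem swendsen_wang_subgraph_comparison
    {V : Type*} [Fintype V] [DecidableEq V]
    (G G₀ : SimpleGraph V) [DecidableRel G.Adj] [DecidableRel G₀.Adj]
    (hsub : G₀ ≤ G)
    (q : ℕ) (hq : 2 ≤ q) (β : ℝ) (hβ : 0 ≤ β) (σ τ : V → Fin q) :
    Real.exp (-β) ^ (G.edgeFinset \ G₀.edgeFinset).card * SW G₀ β q σ τ ≤ SW G β q σ τ ∧
      SW G β q σ τ ≤
        (1 + (q : ℝ) * (Real.exp β - 1)) ^ (G.edgeFinset \ G₀.edgeFinset).card *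
          SW G₀ β q σ τ := by
  have hE : G₀.edgeFinset ⊆ G.edgeFinset := SimpleGraph.edgeFinset_mono hsub
  have hx : 0 ≤ Real.exp β - 1 := sub_nonneg.mpr (Real.one_le_exp hβ)
  have hr : Real.exp (-β) ≤ 1 := Real.exp_le_one_iff.mpr (neg_nonpos.mpr hβ)
  have hr0 : 0 ≤ Real.exp (-β) := (Real.exp_pos _).le
  have hmono : ∀ ρ : V → Fin q, monoEdges G₀ ρ ⊆ monoEdges G ρ :=
    fun ρ => Finset.filter_subset_filter _ hE
  have hinter : monoEdges G₀ σ ∩ monoEdges G₀ τ ⊆ monoEdges G σ ∩ monoEdges G τ :=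
    Finset.inter_subset_inter (hmono σ) (hmono τ)
  have hcard : (monoEdges G σ).card ≤
      (G.edgeFinset \ G₀.edgeFinset).card + (monoEdges G₀ σ).card := by
    refine (Finset.card_le_card fun e he => ?_).trans (Finset.card_union_le _ _)
    simp only [monoEdges, Finset.mem_union, Finset.mem_sdiff, Finset.mem_filter] at he ⊢
    tauto
  have hdiff : (monoEdges G σ ∩ monoEdges G τ) \ (monoEdges G₀ σ ∩ monoEdges G₀ τ) ⊆
      G.edgeFinset \ G₀.edgeFinset := by
    intro e he
    simp only [monoEdges, Finset.mem_inter, Finset.mem_sdiff, Finset.mem_filter] at he ⊢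
    tauto
  have hc : 1 ≤ 1 + (q : ℝ) * (Real.exp β - 1) :=
    le_add_of_nonneg_right (mul_nonneg (Nat.cast_nonneg q) hx)
  have hZ := clusterSum_nonneg hx q (monoEdges G₀ σ ∩ monoEdges G₀ τ)
  rw [SW_eq_clusterSum, SW_eq_clusterSum]
  constructor
  · rw [← mul_assoc, ← pow_add]
    exact mul_le_mul (pow_le_pow_of_le_one hr0 hr hcard) (clusterSum_mono hx q hinter) hZ
      (pow_nonneg hr0 _)
  · have hunion := clusterSum_union_le hx (one_le_two.trans hq)
      (Finset.sdiff_disjoint :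
        Disjoint ((monoEdges G σ ∩ monoEdges G τ) \ (monoEdges G₀ σ ∩ monoEdges G₀ τ)) _)
    rw [Finset.sdiff_union_of_subset hinter] at hunion
    rw [mul_left_comm]
    refine mul_le_mul (pow_le_pow_of_le_one hr0 hr (Finset.card_le_card (hmono σ)))
      (hunion.trans (mul_le_mul_of_nonneg_right ?_ hZ)) (clusterSum_nonneg hx q _)
      (pow_nonneg hr0 _)
    exact pow_le_pow_right₀ hc (Finset.card_le_card hdiff)

end
end

section
/- Let G = (V,E) be a finite simple graph with Swendsen–Wang transition matrix P_G. Then for all σ,τ ∈ Ω_P, every vertex v ∈ V and all colors k,l ∈ [q], P_G(σ^{v,k}, τ^{v,l}) ≤ c₃^{deg_G(v)} · P_G(σ,τ), where c₃ = q·e^{2β} − (q−1)·e^{β}. -/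
open Finset

noncomputable section

/-- Adding the edge `s(u, w)` connects at most the components of `u` and `w`. -/
theorem reachable_of_walk_insert {V : Type*} [DecidableEq V] {A : Finset (Sym2 V)} {u w a b : V}
    (W : (SimpleGraph.fromEdgeSet (↑(insert s(u, w) A) : Set (Sym2 V))).Walk a b) :
    let H := SimpleGraph.fromEdgeSet (↑A : Set (Sym2 V))
    H.Reachable a b ∨ (H.Reachable a u ∧ H.Reachable w b) ∨
      (H.Reachable a w ∧ H.Reachable u b) := by
  intro H
  induction W with
  | nil => exact Or.inl (SimpleGraph.Reachable.refl _)
  | @cons a c b h W ih =>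
    rw [SimpleGraph.fromEdgeSet_adj, Finset.mem_coe, Finset.mem_insert] at h
    obtain ⟨h | h, hne⟩ := h
    · rw [Sym2.eq_iff] at h
      rcases h with ⟨rfl, rfl⟩ | ⟨rfl, rfl⟩
      · rcases ih with h | ⟨-, h⟩ | ⟨-, h⟩
        · exact Or.inr (Or.inl ⟨SimpleGraph.Reachable.refl _, h⟩)
        · exact Or.inr (Or.inl ⟨SimpleGraph.Reachable.refl _, h⟩)
        · exact Or.inl h
      · rcases ih with h | ⟨-, h⟩ | ⟨-, h⟩
        · exact Or.inr (Or.inr ⟨SimpleGraph.Reachable.refl _, h⟩)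
        · exact Or.inl h
        · exact Or.inr (Or.inr ⟨SimpleGraph.Reachable.refl _, h⟩)
    · have hac : H.Reachable a c :=
        SimpleGraph.Adj.reachable ((SimpleGraph.fromEdgeSet_adj _).2 ⟨Finset.mem_coe.2 h, hne⟩)
      rcases ih with h | ⟨h, h'⟩ | ⟨h, h'⟩
      · exact Or.inl (hac.trans h)
      · exact Or.inr (Or.inl ⟨hac.trans h, h'⟩)
      · exact Or.inr (Or.inr ⟨hac.trans h, h'⟩)

/-- The sum of `p ^ |A| * x ^ (n - |A|) * q ^ (-C(A))` over the subsets `A` of `B`. -/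
def percSum {V : Type*} (p x : ℝ) (q n : ℕ) (B : Finset (Sym2 V)) : ℝ :=
  ∑ A ∈ B.powerset, p ^ A.card * x ^ (n - A.card) * ((q : ℝ) ^ numComp A)⁻¹

section percSum

variable {V : Type*} {p x : ℝ} {q n : ℕ} {B : Finset (Sym2 V)}

theorem percSum_nonneg (hp : 0 ≤ p) (hx : 0 ≤ x) : 0 ≤ percSum p x q n B :=
  Finset.sum_nonneg fun A _ => by positivity

theorem percSum_mono (hp : 0 ≤ p) (hx : 0 ≤ x) {B' : Finset (Sym2 V)} (h : B ⊆ B') :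
    percSum p x q n B ≤ percSum p x q n B' :=
  Finset.sum_le_sum_of_subset_of_nonneg (Finset.powerset_mono.2 h)
    fun A _ _ => by positivity

theorem percSum_add (h : B.card ≤ n) (j : ℕ) :
    percSum p x q (n + j) B = x ^ j * percSum p x q n B := by
  rw [percSum, percSum, Finset.mul_sum]
  refine Finset.sum_congr rfl fun A hA => ?_
  have hA' := (Finset.card_le_card (Finset.mem_powerset.1 hA)).trans h
  rw [show n + j - A.card = j + (n - A.card) by omega, pow_add]
  ring

theorem percSum_insert_le [Finite V] [DecidableEq V] (hp : 0 ≤ p) (hx : 0 ≤ x) (hq : 1 ≤ q)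
    (h : B.card ≤ n) {e : Sym2 V} (he : e ∉ B) :
    percSum p x q (n + 1) (insert e B) ≤ (x + p * q) * percSum p x q n B := by
  have hfirst := percSum_add (p := p) (x := x) (q := q) h 1
  rw [pow_one] at hfirst
  rw [percSum, Finset.sum_powerset_insert he, ← percSum, hfirst, add_mul]
  gcongr
  rw [percSum, Finset.mul_sum]
  refine Finset.sum_le_sum fun A hA => ?_
  have heA : e ∉ A := fun h' => he (Finset.mem_powerset.1 hA h')
  have hq0 : (1 : ℝ) ≤ q := by exact_mod_cast hq
  have hq1 : ((q : ℝ) ^ numComp (insert e A))⁻¹ ≤ q * ((q : ℝ) ^ numComp A)⁻¹ := by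
    rw [← div_eq_mul_inv, le_div_iff₀ (by positivity), inv_mul_le_iff₀ (by positivity),
      ← pow_succ]
    exact pow_le_pow_right₀ hq0 (numComp_le_numComp_insert_add_one e A)
  rw [Finset.card_insert_of_notMem heA, Nat.add_sub_add_right]
  calc p ^ (A.card + 1) * x ^ (n - A.card) * ((q : ℝ) ^ numComp (insert e A))⁻¹
      ≤ p ^ (A.card + 1) * x ^ (n - A.card) * (q * ((q : ℝ) ^ numComp A)⁻¹) := by gcongr
    _ = p * q * (p ^ A.card * x ^ (n - A.card) * ((q : ℝ) ^ numComp A)⁻¹) := by ring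

theorem percSum_union_le [Finite V] [DecidableEq V] (hp : 0 ≤ p) (hx : 0 ≤ x) (hq : 1 ≤ q)
    (h : B.card ≤ n) {D : Finset (Sym2 V)} (hD : Disjoint B D) :
    percSum p x q (n + D.card) (B ∪ D) ≤ (x + p * q) ^ D.card * percSum p x q n B := by
  induction D using Finset.induction_on with
  | empty => simp
  | insert e D he ih =>
    rw [Finset.disjoint_insert_right] at hD
    have hcard : (B ∪ D).card ≤ n + D.card :=
      (Finset.card_union_le B D).trans (Nat.add_le_add_right h _)
    have heBD : e ∉ B ∪ D := by simp [hD.1, he]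
    rw [Finset.union_insert, Finset.card_insert_of_notMem he, ← Nat.add_assoc]
    calc percSum p x q (n + D.card + 1) (insert e (B ∪ D))
        ≤ (x + p * q) * percSum p x q (n + D.card) (B ∪ D) :=
          percSum_insert_le hp hx hq hcard heBD
      _ ≤ (x + p * q) * ((x + p * q) ^ D.card * percSum p x q n B) := by
          gcongr
          exact ih hD.2
      _ = (x + p * q) ^ (D.card + 1) * percSum p x q n B := by ring

end percSum

section monoEdges

variable {V : Type*} [Fintype V] [DecidableEq V] (G : SimpleGraph V) [DecidableRel G.Adj] {q : ℕ}

theorem filter_notMem_monoEdges_update (v : V) (k : Fin q) (σ : V → Fin q) :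
    (monoEdges G (Function.update σ v k)).filter (v ∉ ·) = (monoEdges G σ).filter (v ∉ ·) := by
  ext e
  simp only [monoEdges, Finset.mem_filter, and_congr_left_iff, and_congr_right_iff]
  intro hv _
  refine forall₂_congr fun u hu => forall₂_congr fun w hw => ?_
  rw [Function.update_of_ne (ne_of_mem_of_not_mem hu hv),
    Function.update_of_ne (ne_of_mem_of_not_mem hw hv)]

theorem card_filter_mem_monoEdges_le_degree (v : V) (σ : V → Fin q) :
    ((monoEdges G σ).filter (v ∈ ·)).card ≤ G.degree v := by
  rw [← G.card_incidenceFinset_eq_degree v]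
  refine Finset.card_le_card fun e he => ?_
  simp only [monoEdges, Finset.mem_filter, SimpleGraph.mem_edgeFinset] at he
  rw [SimpleGraph.mem_incidenceFinset]
  exact ⟨he.1.1, he.2⟩

/-- Upper bound on the transition probability in terms of the edges not incident to `v`. -/
theorem SW_le_mul_percSum (hq : 1 ≤ q) {β : ℝ} (hβ : 0 ≤ β) (v : V) (σ τ : V → Fin q) :
    SW G β q σ τ ≤ (Real.exp (-β) + (1 - Real.exp (-β)) * q) ^ G.degree v *
      percSum (1 - Real.exp (-β)) (Real.exp (-β)) q ((monoEdges G σ).filter (v ∉ ·)).card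
        ((monoEdges G σ).filter (v ∉ ·) ∩ (monoEdges G τ).filter (v ∉ ·)) := by
  have hx0 : 0 ≤ Real.exp (-β) := (Real.exp_pos _).le
  have hx1 : Real.exp (-β) ≤ 1 := Real.exp_le_one_iff.2 (by linarith)
  have hq0 : (1 : ℝ) ≤ q := by exact_mod_cast hq
  change percSum (1 - Real.exp (-β)) (Real.exp (-β)) q (monoEdges G σ).card
    (monoEdges G σ ∩ monoEdges G τ) ≤ _
  generalize Real.exp (-β) = x at hx0 hx1 ⊢
  have hp0 : 0 ≤ 1 - x := sub_nonneg.2 hx1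
  have hsplit : monoEdges G σ ∩ monoEdges G τ =
      ((monoEdges G σ).filter (v ∉ ·) ∩ (monoEdges G τ).filter (v ∉ ·)) ∪
      ((monoEdges G σ).filter (v ∈ ·) ∩ (monoEdges G τ).filter (v ∈ ·)) := by
    ext e
    simp only [Finset.mem_inter, Finset.mem_union, Finset.mem_filter]
    tauto
  have hcard := Finset.card_filter_add_card_filter_not (s := monoEdges G σ) (v ∈ ·)
  have hdeg := card_filter_mem_monoEdges_le_degree G v σ
  set M := (monoEdges G σ).filter (v ∉ ·)
  set S := (monoEdges G σ).filter (v ∈ ·)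
  set B := M ∩ (monoEdges G τ).filter (v ∉ ·)
  set D := S ∩ (monoEdges G τ).filter (v ∈ ·)
  have hBM : B.card ≤ M.card := Finset.card_le_card Finset.inter_subset_left
  have hDS : D.card ≤ S.card := Finset.card_le_card Finset.inter_subset_left
  have hBD : Disjoint B D := by
    rw [Finset.disjoint_left]
    intro e he he'
    exact (Finset.mem_filter.1 (Finset.mem_inter.1 he).1).2
      (Finset.mem_filter.1 (Finset.mem_inter.1 he').1).2
  have hBDcard : (B ∪ D).card ≤ M.card + D.card :=
    (Finset.card_union_le B D).trans (Nat.add_le_add_right hBM _)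
  rw [hsplit, show (monoEdges G σ).card = M.card + D.card + (S.card - D.card) by omega,
    percSum_add hBDcard]
  calc x ^ (S.card - D.card) * percSum (1 - x) x q (M.card + D.card) (B ∪ D)
      ≤ 1 * percSum (1 - x) x q (M.card + D.card) (B ∪ D) :=
        mul_le_mul_of_nonneg_right (pow_le_one₀ hx0 hx1) (percSum_nonneg hp0 hx0)
    _ ≤ (x + (1 - x) * q) ^ D.card * percSum (1 - x) x q M.card B := by
        rw [one_mul]
        exact percSum_union_le hp0 hx0 hq hBM hBD
    _ ≤ (x + (1 - x) * q) ^ G.degree v * percSum (1 - x) x q M.card B :=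
        mul_le_mul_of_nonneg_right
          (pow_le_pow_right₀ (by nlinarith) (hDS.trans hdeg)) (percSum_nonneg hp0 hx0)

/-- Lower bound on the transition probability in terms of the edges not incident to `v`. -/
theorem mul_percSum_le_SW {β : ℝ} (hβ : 0 ≤ β) (v : V) (σ τ : V → Fin q) :
    Real.exp (-β) ^ G.degree v *
      percSum (1 - Real.exp (-β)) (Real.exp (-β)) q ((monoEdges G σ).filter (v ∉ ·)).card
        ((monoEdges G σ).filter (v ∉ ·) ∩ (monoEdges G τ).filter (v ∉ ·)) ≤ SW G β q σ τ := by
  have hx0 : 0 ≤ Real.exp (-β) := (Real.exp_pos _).le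
  have hx1 : Real.exp (-β) ≤ 1 := Real.exp_le_one_iff.2 (by linarith)
  change _ ≤ percSum (1 - Real.exp (-β)) (Real.exp (-β)) q (monoEdges G σ).card
    (monoEdges G σ ∩ monoEdges G τ)
  generalize Real.exp (-β) = x at hx0 hx1 ⊢
  have hp0 : 0 ≤ 1 - x := sub_nonneg.2 hx1
  have hcard := Finset.card_filter_add_card_filter_not (s := monoEdges G σ) (v ∈ ·)
  refine le_trans ?_ (percSum_mono hp0 hx0 (Finset.inter_subset_inter
    (Finset.filter_subset (v ∉ ·) (monoEdges G σ))
    (Finset.filter_subset (v ∉ ·) (monoEdges G τ))))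
  rw [← hcard, add_comm, percSum_add (Finset.card_le_card Finset.inter_subset_left)]
  exact mul_le_mul_of_nonneg_right (pow_le_pow_of_le_one hx0 hx1
    (card_filter_mem_monoEdges_le_degree G v σ)) (percSum_nonneg hp0 hx0)

end monoEdges

/-- Lemma 4: recoloring a single vertex `v` in both arguments changes the
Swendsen–Wang transition probability by at most `c₃^{deg_G(v)}`, where
`c₃ = q e^{2β} - (q-1) e^β`. -/
theorem swendsen_wang_single_site_comparison
    {V : Type*} [Fintype V] [DecidableEq V]
    (G : SimpleGraph V) [DecidableRel G.Adj]
    (q : ℕ) (hq : 2 ≤ q) (β : ℝ) (hβ : 0 ≤ β)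
    (v : V) (k l : Fin q) (σ τ : V → Fin q) :
    SW G β q (Function.update σ v k) (Function.update τ v l) ≤
      ((q : ℝ) * Real.exp (2 * β) - ((q : ℝ) - 1) * Real.exp β) ^ G.degree v *
        SW G β q σ τ := by
  have hupper := SW_le_mul_percSum G (by omega : 1 ≤ q) hβ v (Function.update σ v k)
    (Function.update τ v l)
  rw [filter_notMem_monoEdges_update, filter_notMem_monoEdges_update] at hupper
  have hlower := mul_percSum_le_SW G hβ v σ τ
  have hq0 : (2 : ℝ) ≤ q := by exact_mod_cast hq
  have hy1 : 1 ≤ Real.exp β := Real.one_le_exp hβ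
  have hx0 : 0 ≤ Real.exp (-β) := (Real.exp_pos _).le
  have hx1 : Real.exp (-β) ≤ 1 := Real.exp_le_one_iff.2 (by linarith)
  have hyx : Real.exp β * Real.exp (-β) = 1 := by
    rw [← Real.exp_add, add_neg_cancel, Real.exp_zero]
  have hy2 : Real.exp (2 * β) = Real.exp β * Real.exp β := by rw [← Real.exp_add, two_mul]
  have hT : 0 ≤ percSum (1 - Real.exp (-β)) (Real.exp (-β)) q
      ((monoEdges G σ).filter (v ∉ ·)).card
      ((monoEdges G σ).filter (v ∉ ·) ∩ (monoEdges G τ).filter (v ∉ ·)) :=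
    percSum_nonneg (sub_nonneg.2 hx1) hx0
  rw [hy2]
  generalize Real.exp (-β) = x at *
  generalize Real.exp β = y at *
  have hc : 0 ≤ (q : ℝ) * (y * y) - (q - 1) * y := by
    nlinarith [mul_nonneg (by positivity : (0 : ℝ) ≤ q * y) (sub_nonneg.2 hy1)]
  have hfac : x + (1 - x) * q ≤ ((q : ℝ) * (y * y) - (q - 1) * y) * x := by
    have heq : ((q : ℝ) * (y * y) - (q - 1) * y) * x = q * y - (q - 1) := by
      linear_combination ((q : ℝ) * y - (q - 1)) * hyx
    rw [heq]
    nlinarith [mul_nonneg (by linarith : (0 : ℝ) ≤ q - 1)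
      (mul_nonneg (sub_nonneg.2 hx1) (sub_nonneg.2 hy1))]
  calc _ ≤ _ := hupper
    _ ≤ (((q : ℝ) * (y * y) - (q - 1) * y) * x) ^ G.degree v * _ :=
        mul_le_mul_of_nonneg_right
          (pow_le_pow_left₀ (by nlinarith) hfac _) hT
    _ ≤ _ := by
        rw [mul_pow, mul_assoc]
        exact mul_le_mul_of_nonneg_left hlower (pow_nonneg hc _)

end
end
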